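/- arXiv:2103.01645 — 3 statements merged into one kernel-verified Lean document; each statement's English description precedes it below -/
import Mathlib

section
/- Let M₁ and M₂ be two distinct invertible 2 × 2 matrices with rational entries. Then there exist constants c > 0, C > 0 and a threshold N₀ (depending on the matrices) such that for every n ≥ N₀, every set A ⊆ [n] × [n] ⊂ ℤ² containing no configuration x, x + M₁y, x + M₂y with y ∈ ℤ², y ≠ 0, satisfies |A| ≤ C·n²/(log n)^{c}. -/
namespace TwoMatrix

open Finset Matrix

section Fourier

variable {p : ℕ} [Fact p.Prime]

lemma sum_stdAddChar_dotProduct (v : Fin 2 → ZMod p) :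
    ∑ ξ : Fin 2 → ZMod p, (ZMod.stdAddChar (ξ ⬝ᵥ v) : ℂ) = if v = 0 then (p : ℂ) ^ 2 else 0 := by
  classical
  let g : (Fin 2 → ZMod p) →+ ZMod p :=
    { toFun := fun ξ => ξ ⬝ᵥ v
      map_zero' := zero_dotProduct v
      map_add' := fun a b => add_dotProduct a b v }
  have h := AddChar.sum_eq_ite ((ZMod.stdAddChar (N := p)).compAddMonoidHom g)
  have hiff : (ZMod.stdAddChar (N := p)).compAddMonoidHom g = 0 ↔ v = 0 := by
    constructor
    · intro h0
      funext i
      have h1 : ZMod.stdAddChar (Pi.single i 1 ⬝ᵥ v) = (1 : ℂ) := by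
        exact DFunLike.congr_fun h0 (Pi.single i 1)
      rw [single_one_dotProduct] at h1
      apply ZMod.injective_stdAddChar
      rw [h1, Pi.zero_apply, AddChar.map_zero_eq_one]
    · rintro rfl
      ext ξ
      simp [g]
  simp only [hiff] at h
  simpa [g, ZMod.card] using h

/-- The Fourier transform of a real function on `(ℤ/p)²`. -/
noncomputable def fourier (f : (Fin 2 → ZMod p) → ℝ) (ξ : Fin 2 → ZMod p) : ℂ :=
  ∑ x, (f x : ℂ) * ZMod.stdAddChar (ξ ⬝ᵥ x)

lemma fourier_add (f g : (Fin 2 → ZMod p) → ℝ) (ξ : Fin 2 → ZMod p) :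
    fourier (f + g) ξ = fourier f ξ + fourier g ξ := by
  simp [fourier, add_mul, sum_add_distrib]

lemma fourier_smul (c : ℝ) (f : (Fin 2 → ZMod p) → ℝ) (ξ : Fin 2 → ZMod p) :
    fourier (c • f) ξ = c * fourier f ξ := by
  simp [fourier, mul_sum, mul_assoc]

lemma norm_fourier_le (f : (Fin 2 → ZMod p) → ℝ) (ξ : Fin 2 → ZMod p) :
    ‖fourier f ξ‖ ≤ ∑ x, |f x| := by
  refine (norm_sum_le _ _).trans (sum_le_sum fun x _ => ?_)
  simp [AddChar.norm_apply]

lemma sum_norm_fourier_sq (f : (Fin 2 → ZMod p) → ℝ) :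
    ∑ ξ, ‖fourier f ξ‖ ^ 2 = (p : ℝ) ^ 2 * ∑ x, f x ^ 2 := by
  have h : ∀ ξ, ((‖fourier f ξ‖ ^ 2 : ℝ) : ℂ) =
      ∑ x, ∑ y, (f x : ℂ) * f y * ZMod.stdAddChar (ξ ⬝ᵥ (x - y)) := by
    intro ξ
    push_cast
    rw [← Complex.mul_conj']
    simp only [fourier, map_sum, map_mul, Complex.conj_ofReal, sum_mul_sum]
    refine sum_congr rfl fun x _ => sum_congr rfl fun y _ => ?_
    rw [← AddChar.map_neg_eq_conj, dotProduct_sub, sub_eq_add_neg, AddChar.map_add_eq_mul]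
    ring
  apply Complex.ofReal_injective
  rw [Complex.ofReal_sum, sum_congr rfl fun ξ _ => h ξ, sum_comm]
  simp only [Complex.ofReal_mul, Complex.ofReal_sum, mul_sum]
  refine sum_congr rfl fun x _ => ?_
  rw [sum_comm]
  simp only [← mul_sum, sum_stdAddChar_dotProduct, sub_eq_zero]
  simp
  ring

/-- The trilinear form counting weighted solutions of `T₀ x + T₁ y + T₂ z = 0`. -/
noncomputable def trilinear (T₀ T₁ T₂ : Matrix (Fin 2) (Fin 2) (ZMod p))
    (f g h : (Fin 2 → ZMod p) → ℝ) : ℝ :=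
  ∑ x, ∑ y, ∑ z, f x * g y * h z * if T₀ *ᵥ x + T₁ *ᵥ y + T₂ *ᵥ z = 0 then 1 else 0

variable (T₀ T₁ T₂ : Matrix (Fin 2) (Fin 2) (ZMod p))

lemma sq_mul_trilinear (f g h : (Fin 2 → ZMod p) → ℝ) :
    (((p : ℝ) ^ 2 * trilinear T₀ T₁ T₂ f g h : ℝ) : ℂ) =
      ∑ ξ, fourier f (ξ ᵥ* T₀) * fourier g (ξ ᵥ* T₁) * fourier h (ξ ᵥ* T₂) := by
  have key : ∀ ξ, fourier f (ξ ᵥ* T₀) * fourier g (ξ ᵥ* T₁) * fourier h (ξ ᵥ* T₂) =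
      ∑ x, ∑ y, ∑ z, (f x : ℂ) * g y * h z *
        ZMod.stdAddChar (ξ ⬝ᵥ (T₀ *ᵥ x + T₁ *ᵥ y + T₂ *ᵥ z)) := by
    intro ξ
    simp only [fourier]
    rw [sum_mul_sum, sum_mul]
    refine sum_congr rfl fun x _ => ?_
    rw [sum_mul]
    refine sum_congr rfl fun y _ => ?_
    rw [mul_sum]
    refine sum_congr rfl fun z _ => ?_
    rw [dotProduct_add, dotProduct_add, AddChar.map_add_eq_mul, AddChar.map_add_eq_mul,
      dotProduct_mulVec, dotProduct_mulVec, dotProduct_mulVec]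
    ring
  simp only [key]
  symm
  rw [sum_comm]
  simp only [trilinear, mul_sum, Complex.ofReal_mul, Complex.ofReal_sum]
  refine sum_congr rfl fun x _ => ?_
  rw [sum_comm]
  refine sum_congr rfl fun y _ => ?_
  rw [sum_comm]
  refine sum_congr rfl fun z _ => ?_
  rw [← mul_sum, sum_stdAddChar_dotProduct]
  split_ifs <;> push_cast <;> ring

lemma sum_comp_vecMul {T : Matrix (Fin 2) (Fin 2) (ZMod p)} (hT : T.det ≠ 0)
    (F : (Fin 2 → ZMod p) → ℝ) : ∑ ξ, F (ξ ᵥ* T) = ∑ ξ, F ξ := by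
  have hinj : Function.Injective fun ξ : Fin 2 → ZMod p => ξ ᵥ* T :=
    vecMul_injective_iff_isUnit.2 ((isUnit_iff_isUnit_det T).2 hT.isUnit)
  exact (hinj.bijective_of_finite).sum_comp F

lemma mul_mul_le_add_pow_three {x y z : ℝ} (hx : 0 ≤ x) (hy : 0 ≤ y) (hz : 0 ≤ z) :
    x * y * z ≤ x ^ 3 + y ^ 3 + z ^ 3 := by
  nlinarith [mul_nonneg (add_nonneg (add_nonneg hx hy) hz)
      (add_nonneg (add_nonneg (sq_nonneg (x - y)) (sq_nonneg (y - z))) (sq_nonneg (x - z))),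
    mul_nonneg (mul_nonneg hx hy) hz]

variable {T₀ T₁ T₂}

lemma abs_trilinear_le (h₀ : T₀.det ≠ 0) (h₁ : T₁.det ≠ 0) (h₂ : T₂.det ≠ 0)
    {f g h : (Fin 2 → ZMod p) → ℝ} {a b c : ℝ} (ha : 0 < a) (hb : 0 < b) (hc : 0 < c)
    (hf : ∑ ξ, ‖fourier f ξ‖ ^ 3 ≤ a ^ 3) (hg : ∑ ξ, ‖fourier g ξ‖ ^ 3 ≤ b ^ 3)
    (hh : ∑ ξ, ‖fourier h ξ‖ ^ 3 ≤ c ^ 3) :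
    (p : ℝ) ^ 2 * |trilinear T₀ T₁ T₂ f g h| ≤ 3 * (a * b * c) := by
  have hp : (p : ℝ) ^ 2 * |trilinear T₀ T₁ T₂ f g h| =
      ‖(((p : ℝ) ^ 2 * trilinear T₀ T₁ T₂ f g h : ℝ) : ℂ)‖ := by
    rw [Complex.norm_real, Real.norm_eq_abs, abs_mul, abs_of_nonneg (sq_nonneg (p : ℝ))]
  rw [hp, sq_mul_trilinear]
  have hscale : ∀ {t : ℝ} {F : (Fin 2 → ZMod p) → ℝ}, 0 < t →
      ∑ ξ, ‖fourier F ξ‖ ^ 3 ≤ t ^ 3 → ∑ ξ, (‖fourier F ξ‖ / t) ^ 3 ≤ 1 := by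
    intro t F ht hF
    simp only [div_pow]
    rw [← sum_div, div_le_one (by positivity)]
    exact hF
  calc _ ≤ ∑ ξ, ‖fourier f (ξ ᵥ* T₀)‖ * ‖fourier g (ξ ᵥ* T₁)‖ * ‖fourier h (ξ ᵥ* T₂)‖ := by
        refine (norm_sum_le _ _).trans (le_of_eq ?_)
        simp only [norm_mul]
    _ ≤ ∑ ξ, (a * b * c) * ((‖fourier f (ξ ᵥ* T₀)‖ / a) ^ 3 + (‖fourier g (ξ ᵥ* T₁)‖ / b) ^ 3
          + (‖fourier h (ξ ᵥ* T₂)‖ / c) ^ 3) := by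
        refine sum_le_sum fun ξ _ => ?_
        have := mul_mul_le_add_pow_three
          (x := ‖fourier f (ξ ᵥ* T₀)‖ / a) (y := ‖fourier g (ξ ᵥ* T₁)‖ / b)
          (z := ‖fourier h (ξ ᵥ* T₂)‖ / c) (by positivity) (by positivity) (by positivity)
        refine le_trans (le_of_eq ?_)
          (mul_le_mul_of_nonneg_left this (by positivity : 0 ≤ a * b * c))
        field_simp
    _ ≤ (a * b * c) * (1 + 1 + 1) := by
        rw [← mul_sum, sum_add_distrib, sum_add_distrib,
          sum_comp_vecMul h₀ fun ξ => (‖fourier f ξ‖ / a) ^ 3,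
          sum_comp_vecMul h₁ fun ξ => (‖fourier g ξ‖ / b) ^ 3,
          sum_comp_vecMul h₂ fun ξ => (‖fourier h ξ‖ / c) ^ 3]
        exact mul_le_mul_of_nonneg_left
          (add_le_add (add_le_add (hscale ha hf) (hscale hb hg)) (hscale hc hh)) (by positivity)
    _ = 3 * (a * b * c) := by ring

/-- The sum of `f` over the translates of a finite family of shifts. -/
noncomputable def shiftSum {ι : Type*} (U : Finset ι) (s : ι → Fin 2 → ZMod p)
    (f : (Fin 2 → ZMod p) → ℝ) (x : Fin 2 → ZMod p) : ℝ :=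
  ∑ u ∈ U, f (x + s u)

lemma fourier_shiftSum {ι : Type*} (U : Finset ι) (s : ι → Fin 2 → ZMod p)
    (f : (Fin 2 → ZMod p) → ℝ) (ξ : Fin 2 → ZMod p) :
    fourier (shiftSum U s f) ξ =
      fourier f ξ * ∑ u ∈ U, (starRingEnd ℂ) (ZMod.stdAddChar (ξ ⬝ᵥ s u)) := by
  simp only [fourier, shiftSum, Complex.ofReal_sum, sum_mul]
  rw [sum_comm, ← sum_mul, mul_sum]
  refine sum_congr rfl fun u _ => ?_
  rw [sum_mul, ← (Equiv.subRight (s u)).sum_comp]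
  refine sum_congr rfl fun x _ => ?_
  rw [← AddChar.map_neg_eq_conj, mul_assoc, ← AddChar.map_add_eq_mul]
  simp [sub_eq_add_neg]

lemma sum_shiftSum {ι : Type*} (U : Finset ι) (s : ι → Fin 2 → ZMod p)
    (f : (Fin 2 → ZMod p) → ℝ) : ∑ x, shiftSum U s f x = #U * ∑ x, f x := by
  simp only [shiftSum]
  have h : ∀ u ∈ U, ∑ x, f (x + s u) = ∑ x, f x := fun u _ =>
    Fintype.sum_equiv (Equiv.addRight (s u)) _ _ fun _ => rfl
  rw [sum_comm, sum_congr rfl h]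
  simp

end Fourier

section Pigeonhole

/-- A function with large cubic mean has a level set on which the sum of squares is at least a fixed
power of the size of the level set. -/
lemma exists_level_set {Ω : Type*} [Fintype Ω] (a : Ω → ℝ) (ha₀ : ∀ ω, 0 ≤ a ω) (ha₁ : ∀ ω, a ω ≤ 1)
    {δ : ℝ} (hδ : 0 < δ) (hsum : 2 * δ ≤ ∑ ω, a ω ^ 3) :
    ∃ S : Finset Ω, S.Nonempty ∧ (#S : ℝ) * (δ ^ 4 / 2 ^ 20) ≤ (∑ ω ∈ S, a ω ^ 2) ^ 5 := by
  classical
  let S : ℕ → Finset Ω := fun j => {ω | (1 / 4 : ℝ) ^ (j + 1) < a ω ∧ a ω ≤ (1 / 4) ^ j}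
  obtain ⟨j, hj⟩ : ∃ j, δ * (1 / 2) ^ j < ∑ ω ∈ S j, a ω ^ 3 := by
    by_contra! hcon
    have hex : ∀ ω, ∃ n, 0 < a ω → ω ∈ S n := by
      intro ω
      by_cases h : 0 < a ω
      · obtain ⟨n, hn₁, hn₂⟩ := exists_nat_pow_near_of_lt_one h (ha₁ ω)
          (by norm_num : (0 : ℝ) < 1 / 4) (by norm_num)
        exact ⟨n, fun _ => by simp only [S, mem_filter, mem_univ, true_and]; exact ⟨hn₁, hn₂⟩⟩
      · exact ⟨0, fun h' => absurd h' h⟩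
    choose n hn using hex
    have hle : ∑ ω, a ω ^ 3 ≤ ∑ j ∈ range (univ.sup n + 1), ∑ ω ∈ S j, a ω ^ 3 := by
      simp only [S, sum_filter]
      rw [sum_comm]
      refine sum_le_sum fun ω _ => ?_
      have hnn : ∀ j ∈ range (univ.sup n + 1),
          0 ≤ if (1 / 4 : ℝ) ^ (j + 1) < a ω ∧ a ω ≤ (1 / 4) ^ j then a ω ^ 3 else 0 := by
        intro j _
        have := pow_nonneg (ha₀ ω) 3
        split_ifs <;> simp [this]
      rcases (ha₀ ω).eq_or_lt with h0 | hpos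
      · rw [← h0]
        simp
      · refine le_trans (le_of_eq ?_) (single_le_sum hnn
          (mem_range.2 (Nat.lt_succ_of_le (le_sup (f := n) (mem_univ ω)))))
        have := hn ω hpos
        simp only [S, mem_filter, mem_univ, true_and] at this
        rw [if_pos this]
    have hgeom : ∑ j ∈ range (univ.sup n + 1), δ * (1 / 2 : ℝ) ^ j < 2 * δ := by
      rw [← mul_sum, geom_sum_eq (by norm_num)]
      have : (0 : ℝ) < (1 / 2) ^ (univ.sup n + 1) := by positivity
      rw [mul_comm 2 δ]
      refine mul_lt_mul_of_pos_left ?_ hδ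
      rw [div_lt_iff_of_neg (by norm_num)]
      linarith
    have := hle.trans (sum_le_sum fun j _ => hcon j)
    linarith
  have hmem : ∀ ω ∈ S j, (1 / 4 : ℝ) ^ (j + 1) < a ω ∧ a ω ≤ (1 / 4) ^ j := by
    intro ω hω
    simpa only [S, mem_filter, mem_univ, true_and] using hω
  refine ⟨S j, ?_, ?_⟩
  · rw [nonempty_iff_ne_empty]
    intro h
    rw [h, sum_empty] at hj
    have : 0 < δ * (1 / 2) ^ j := by positivity
    linarith
  have hk : δ * (1 / 2) ^ j ≤ #(S j) * ((1 / 4 : ℝ) ^ j) ^ 3 := by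
    refine hj.le.trans ?_
    rw [← nsmul_eq_mul]
    exact sum_le_card_nsmul _ _ _ fun ω hω => pow_le_pow_left₀ (ha₀ ω) (hmem ω hω).2 3
  have hE : #(S j) * ((1 / 4 : ℝ) ^ (j + 1)) ^ 2 ≤ ∑ ω ∈ S j, a ω ^ 2 := by
    rw [← nsmul_eq_mul]
    exact card_nsmul_le_sum _ _ _ fun ω hω => pow_le_pow_left₀ (by positivity) (hmem ω hω).1.le 2
  have e4 : (1 / 4 : ℝ) ^ j = ((1 / 2) ^ j) ^ 2 := by rw [← pow_mul, mul_comm, pow_mul]; norm_num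
  rw [e4] at hk
  rw [pow_succ (1 / 4 : ℝ) j, e4] at hE
  set t : ℝ := (1 / 2) ^ j with ht
  have htpos : 0 < t := by positivity
  set k : ℝ := (#(S j) : ℝ)
  have hk0 : 0 ≤ k := Nat.cast_nonneg _
  have hk' : δ ≤ k * t ^ 5 := by
    refine le_of_mul_le_mul_right (a := t) ?_ htpos
    linarith [hk]
  calc k * (δ ^ 4 / 2 ^ 20) ≤ k * ((k * t ^ 5) ^ 4 / 2 ^ 20) := by gcongr
    _ = (k * (t ^ 2 * (1 / 4)) ^ 2) ^ 5 := by ring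
    _ ≤ _ := by gcongr

/-- Simultaneous Dirichlet approximation modulo `p`. -/
lemma exists_dilate_small {p : ℕ} [Fact p.Prime] (S : Finset (Fin 2 → ZMod p)) {M : ℕ}
    (hM : 0 < M) :
    ∃ q : ℕ, 0 < q ∧ q ≤ M ^ (2 * #S) ∧ ∀ ξ ∈ S, ∀ i, ∃ r : ℤ, |r| * M ≤ p ∧
      (q : ZMod p) * ξ i = r := by
  have hp : 0 < p := (Fact.out : p.Prime).pos
  have hlt : ∀ x : ZMod p, x.val * M / p < M := fun x => by
    rw [Nat.div_lt_iff_lt_mul hp, mul_comm]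
    exact Nat.mul_lt_mul_of_pos_left (ZMod.val_lt x) hM
  let F : Fin (M ^ (2 * #S) + 1) → (S × Fin 2 → Fin M) := fun q s =>
    ⟨(((q : ℕ) : ZMod p) * s.1.1 s.2).val * M / p, hlt _⟩
  obtain ⟨x, y, hxy, hF⟩ := Fintype.exists_ne_map_eq_of_card_lt F (by
    simp [mul_comm])
  wlog hlt' : x < y generalizing x y
  · exact this y x hxy.symm hF.symm (lt_of_le_of_ne (not_lt.1 hlt') hxy.symm)
  have hltN : (x : ℕ) < y := hlt'
  refine ⟨y - x, by omega, by omega, fun ξ hξ i => ?_⟩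
  have h1 := congrArg Fin.val (congrFun hF (⟨ξ, hξ⟩, i))
  simp only [F] at h1
  set vx := (((x : ℕ) : ZMod p) * ξ i).val with hvx
  set vy := (((y : ℕ) : ZMod p) * ξ i).val with hvy
  refine ⟨(vy : ℤ) - vx, ?_, ?_⟩
  · have hx1 := Nat.div_add_mod (vx * M) p
    have hx2 := Nat.mod_lt (vx * M) hp
    have hy1 := Nat.div_add_mod (vy * M) p
    have hy2 := Nat.mod_lt (vy * M) hp
    rw [h1] at hx1
    have hM' : (M : ℤ) = |(M : ℤ)| := (abs_of_nonneg (by positivity)).symm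
    rw [hM', ← abs_mul, sub_mul, abs_le]
    zify at hx1 hx2 hy1 hy2
    constructor <;> linarith [Int.emod_nonneg ((vx : ℤ) * M) (by positivity : (p : ℤ) ≠ 0),
      Int.emod_nonneg ((vy : ℤ) * M) (by positivity : (p : ℤ) ≠ 0)]
  · rw [Nat.cast_sub hltN.le, sub_mul]
    push_cast
    rw [hvx, hvy, ZMod.natCast_zmod_val, ZMod.natCast_zmod_val]

lemma half_le_re_stdAddChar {p : ℕ} [Fact p.Prime] {r : ℤ} (hr : |r| * 6 ≤ p) :
    1 / 2 ≤ (ZMod.stdAddChar (r : ZMod p) : ℂ).re := by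
  have hp : (0 : ℝ) < p := Nat.cast_pos.2 (Fact.out : p.Prime).pos
  have h : (2 * Real.pi * Complex.I * r / p : ℂ) = ((2 * Real.pi * (r / p) : ℝ) : ℂ) * Complex.I := by
    push_cast; ring
  rw [ZMod.stdAddChar_coe, h, Complex.exp_ofReal_mul_I_re, ← Real.cos_pi_div_three,
    ← Real.cos_abs (2 * Real.pi * (r / p))]
  have hr' : |(r : ℝ)| * 6 ≤ p := by exact_mod_cast hr
  apply Real.cos_le_cos_of_nonneg_of_le_pi (abs_nonneg _)
  · linarith [Real.pi_pos]
  · rw [abs_mul, abs_of_pos (by positivity), abs_div, abs_of_pos hp]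
    have : |(r : ℝ)| / p ≤ 1 / 6 := by rw [div_le_iff₀ hp]; linarith
    nlinarith [Real.pi_pos]

end Pigeonhole

section Lattice

/-- The box `[0, N)²` in `ℤ²`. -/
noncomputable def box (N : ℕ) : Finset (Fin 2 → ℤ) := Fintype.piFinset fun _ => Ico 0 (N : ℤ)

lemma mem_box {N : ℕ} {a : Fin 2 → ℤ} : a ∈ box N ↔ ∀ i, 0 ≤ a i ∧ a i < N := by
  simp [box]

lemma card_box (N : ℕ) : #(box N) = N ^ 2 := by
  simp [box]

lemma mulVec_injective_of_det_ne_zero {T : Matrix (Fin 2) (Fin 2) ℤ} (hT : T.det ≠ 0)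
    {a b : Fin 2 → ℤ} (h : T *ᵥ a = T *ᵥ b) : a = b := by
  rw [← sub_eq_zero] at h ⊢
  rw [← mulVec_sub] at h
  exact eq_zero_of_mulVec_eq_zero hT h

/-- A bound for the size of the coordinates of `T *ᵥ a`, for `a` in the unit box. -/
def entrySum (T : Matrix (Fin 2) (Fin 2) ℤ) : ℕ := ∑ i, ∑ j, (T i j).natAbs

lemma abs_mulVec_le (T : Matrix (Fin 2) (Fin 2) ℤ) {N : ℤ} {a : Fin 2 → ℤ} (ha : ∀ i, |a i| ≤ N)
    (i : Fin 2) : |(T *ᵥ a) i| ≤ entrySum T * N := by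
  have hN : 0 ≤ N := (abs_nonneg _).trans (ha 0)
  have hterm : ∀ j, |T i j * a j| ≤ |T i j| * N := fun j => by
    rw [abs_mul]
    exact mul_le_mul_of_nonneg_left (ha j) (abs_nonneg _)
  calc |(T *ᵥ a) i| = |T i 0 * a 0 + T i 1 * a 1| := by
        rw [mulVec, dotProduct, Fin.sum_univ_two]
    _ ≤ |T i 0| * N + |T i 1| * N := (abs_add_le _ _).trans (add_le_add (hterm 0) (hterm 1))
    _ = (∑ j, |T i j|) * N := by rw [Fin.sum_univ_two, add_mul]
    _ ≤ entrySum T * N := by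
        have hE : (entrySum T : ℤ) = ∑ i, ∑ j, |T i j| := by simp [entrySum]
        rw [hE]
        exact mul_le_mul_of_nonneg_right (single_le_sum (f := fun i => ∑ j, |T i j|)
          (fun i _ => sum_nonneg fun j _ => abs_nonneg _) (mem_univ i)) hN

variable (T₀ T₁ T₂ : Matrix (Fin 2) (Fin 2) ℤ)

/-- The solutions of `T₀ a + T₁ b + T₂ c = 0` in a box are a positive proportion of the maximal
possible number. -/
lemma exists_box_solutions (hsum : T₀ + T₁ + T₂ = 0) (h₁ : T₁.det ≠ 0) :
    ∃ c : ℝ, 0 < c ∧ c ≤ 1 ∧ ∃ N₁ : ℕ, ∀ N : ℕ, N₁ ≤ N → c * (N : ℝ) ^ 4 ≤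
      #{t ∈ box N ×ˢ box N ×ˢ box N | T₀ *ᵥ t.1 + T₁ *ᵥ t.2.1 + T₂ *ᵥ t.2.2 = 0} := by
  set P : Matrix (Fin 2) (Fin 2) ℤ := T₁.adjugate * T₂ with hP
  set H : ℕ := T₁.det.natAbs + entrySum P + 1 with hH
  have hHpos : (0 : ℝ) < H := by positivity
  refine ⟨(1 / (6 * H)) ^ 4, by positivity, ?_, 3 * H, fun N hN => ?_⟩
  · refine pow_le_one₀ (by positivity) ?_
    rw [div_le_one (by positivity)]
    have : (1 : ℝ) ≤ H := by exact_mod_cast (by omega : 1 ≤ H)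
    linarith
  set m : ℕ := N / (3 * H) with hm
  have hm1 : 1 ≤ m := (Nat.one_le_div_iff (by omega)).2 hN
  have hmle : m * (3 * H) ≤ N := Nat.div_mul_le_self _ _
  have hmlt : N < (m + 1) * (3 * H) := by
    rw [mul_comm]; exact Nat.lt_mul_div_succ N (by omega)
  have hmN : (N : ℝ) ≤ m * (6 * H) := by
    have : N ≤ m * (6 * H) := by nlinarith
    exact_mod_cast this
  let F : (Fin 2 → ℤ) × (Fin 2 → ℤ) → (Fin 2 → ℤ) × (Fin 2 → ℤ) × (Fin 2 → ℤ) := fun t =>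
    let x : Fin 2 → ℤ := t.1 + fun _ => (H * m : ℤ)
    (x, x - P *ᵥ t.2, x + T₁.det • t.2)
  have hcard : #(box m ×ˢ box m) ≤
      #{t ∈ box N ×ˢ box N ×ˢ box N | T₀ *ᵥ t.1 + T₁ *ᵥ t.2.1 + T₂ *ᵥ t.2.2 = 0} := by
    refine card_le_card_of_injOn F ?_ ?_
    · rintro ⟨y, s⟩ hys
      simp only [coe_product, Set.mem_prod, mem_coe, mem_box] at hys
      obtain ⟨hy, hs⟩ := hys
      have hsabs : ∀ i, |s i| ≤ (m : ℤ) := fun i => abs_le.2 ⟨by linarith [hs i], (hs i).2.le⟩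
      have hz : (m : ℤ) * (3 * H) ≤ N := by exact_mod_cast hmle
      have hm1' : (1 : ℤ) ≤ m := by exact_mod_cast hm1
      have hHz : (H : ℤ) = |T₁.det| + entrySum P + 1 := by
        rw [hH]; push_cast; rfl
      have hE0 : (0 : ℤ) ≤ entrySum P := Int.natCast_nonneg _
      have hD0 : 0 ≤ |T₁.det| := abs_nonneg _
      simp only [F, coe_filter, mem_product, mem_box, Set.mem_ofPred_eq, Pi.add_apply, Pi.sub_apply,
        Pi.smul_apply, smul_eq_mul]
      refine ⟨⟨fun i => ?_, fun i => ?_, fun i => ?_⟩, ?_⟩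
      · constructor <;> nlinarith [hy i]
      · have h := abs_le.1 (abs_mulVec_le P hsabs i)
        constructor <;> nlinarith [hy i, h.1, h.2]
      · have h : |T₁.det * s i| ≤ |T₁.det| * m := by
          rw [abs_mul]; exact mul_le_mul_of_nonneg_left (hsabs i) hD0
        have h := abs_le.1 h
        constructor <;> nlinarith [hy i, h.1, h.2]
      · have hT₀ : T₀ = -(T₁ + T₂) := eq_neg_of_add_eq_zero_left (by rw [← hsum]; abel)
        have hadj : T₁ *ᵥ (P *ᵥ s) = T₁.det • (T₂ *ᵥ s) := by
          rw [hP, mulVec_mulVec, ← Matrix.mul_assoc, mul_adjugate, smul_mul, Matrix.one_mul,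
            smul_mulVec]
        rw [hT₀, neg_mulVec, add_mulVec, mulVec_sub, mulVec_add T₂ _ (T₁.det • s), mulVec_smul, hadj]
        abel
    · rintro ⟨y, s⟩ - ⟨y', s'⟩ - h
      simp only [F, Prod.mk.injEq, add_left_inj] at h
      obtain ⟨rfl, -, h⟩ := h
      rw [add_right_inj] at h
      rw [smul_right_injective _ h₁ h]
  rw [card_product, card_box] at hcard
  calc (1 / (6 * (H : ℝ))) ^ 4 * (N : ℝ) ^ 4 = (N / (6 * H)) ^ 4 := by ring
    _ ≤ (m : ℝ) ^ 4 := by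
        refine pow_le_pow_left₀ (by positivity) ?_ 4
        rw [div_le_iff₀ (by positivity)]
        exact hmN
    _ = ((m ^ 2 * m ^ 2 : ℕ) : ℝ) := by push_cast; ring
    _ ≤ _ := by exact_mod_cast hcard

end Lattice

section Pushforward

variable {p : ℕ}

/-- Coordinatewise reduction modulo `p`. -/
def red (p : ℕ) (a : Fin 2 → ℤ) : Fin 2 → ZMod p := fun i => (a i : ZMod p)

lemma red_add (a b : Fin 2 → ℤ) : red p (a + b) = red p a + red p b := by
  funext i; simp [red]

lemma red_sub (a b : Fin 2 → ℤ) : red p (a - b) = red p a - red p b := by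
  funext i; simp [red]

lemma red_mulVec (T : Matrix (Fin 2) (Fin 2) ℤ) (a : Fin 2 → ℤ) :
    red p (T *ᵥ a) = T.map (Int.castRingHom (ZMod p)) *ᵥ red p a := by
  funext i
  exact RingHom.map_mulVec (Int.castRingHom (ZMod p)) T a i

lemma eq_zero_of_red_eq_zero {a : Fin 2 → ℤ} (h : red p a = 0) (ha : ∀ i, |a i| < p) : a = 0 := by
  funext i
  exact Int.eq_zero_of_abs_lt_dvd ((ZMod.intCast_zmod_eq_zero_iff_dvd _ _).1 (congrFun h i)) (ha i)

lemma red_injOn_box {N : ℕ} (hN : N ≤ p) : Set.InjOn (red p) (box N : Set (Fin 2 → ℤ)) := by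
  intro a ha b hb h
  rw [mem_coe, mem_box] at ha hb
  rw [← sub_eq_zero]
  refine eq_zero_of_red_eq_zero (p := p) (by rw [red_sub, h, sub_self]) fun i => ?_
  have hN' : (N : ℤ) ≤ p := by exact_mod_cast hN
  rw [Pi.sub_apply, abs_lt]
  constructor <;> linarith [ha i, hb i]

/-- The pushforward to `(ℤ/p)²` of the counting measure on a finite set of lattice points. -/
noncomputable def push (p : ℕ) (X : Finset (Fin 2 → ℤ)) (v : Fin 2 → ZMod p) : ℝ :=
  ∑ a ∈ X, if red p a = v then 1 else 0

lemma push_nonneg (X : Finset (Fin 2 → ℤ)) (v : Fin 2 → ZMod p) : 0 ≤ push p X v :=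
  sum_nonneg fun a _ => by split_ifs <;> norm_num

lemma one_le_push {X : Finset (Fin 2 → ℤ)} {a : Fin 2 → ℤ} (ha : a ∈ X) : 1 ≤ push p X (red p a) := by
  refine le_trans (by simp) (single_le_sum (f := fun b => if red p b = red p a then (1 : ℝ) else 0)
    (fun b _ => by split_ifs <;> norm_num) ha)

lemma push_le_one {X : Finset (Fin 2 → ℤ)} (hX : Set.InjOn (red p) (X : Set (Fin 2 → ℤ)))
    (v : Fin 2 → ZMod p) : push p X v ≤ 1 := by
  rw [push, ← sum_filter, sum_const, nsmul_eq_mul, mul_one]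
  have : #{a ∈ X | red p a = v} ≤ 1 := card_le_one.2 fun a ha b hb => by
    rw [mem_filter] at ha hb
    exact hX ha.1 hb.1 (ha.2.trans hb.2.symm)
  exact_mod_cast this

lemma exists_mem_of_push_ne_zero {X : Finset (Fin 2 → ℤ)} {v : Fin 2 → ZMod p}
    (h : push p X v ≠ 0) : ∃ a ∈ X, red p a = v := by
  obtain ⟨a, ha, h⟩ := exists_ne_zero_of_sum_ne_zero h
  exact ⟨a, ha, by by_contra hne; exact h (if_neg hne)⟩

variable [Fact p.Prime]

lemma sum_push_mul (X : Finset (Fin 2 → ℤ)) (g : (Fin 2 → ZMod p) → ℝ) :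
    ∑ v, push p X v * g v = ∑ a ∈ X, g (red p a) := by
  simp only [push, sum_mul]
  rw [sum_comm]
  exact sum_congr rfl fun a _ => by simp

lemma sum_push (X : Finset (Fin 2 → ℤ)) : ∑ v, push p X v = #X := by
  simpa using sum_push_mul (p := p) X fun _ => 1

lemma trilinear_push (T₀ T₁ T₂ : Matrix (Fin 2) (Fin 2) ℤ) (X : Finset (Fin 2 → ℤ)) :
    trilinear (T₀.map (Int.castRingHom (ZMod p))) (T₁.map (Int.castRingHom (ZMod p)))
      (T₂.map (Int.castRingHom (ZMod p))) (push p X) (push p X) (push p X) =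
      #{t ∈ X ×ˢ X ×ˢ X | red p (T₀ *ᵥ t.1 + T₁ *ᵥ t.2.1 + T₂ *ᵥ t.2.2) = 0} := by
  rw [card_filter, sum_product, Nat.cast_sum]
  simp only [trilinear, mul_assoc, ← mul_sum, sum_push_mul, ← red_mulVec, ← red_add]
  refine sum_congr rfl fun a _ => ?_
  rw [sum_product]
  push_cast
  rfl

lemma sum_push_sq_le {X : Finset (Fin 2 → ℤ)} (hX : Set.InjOn (red p) (X : Set (Fin 2 → ℤ))) :
    ∑ v, push p X v ^ 2 ≤ #X := by
  rw [← sum_push (p := p)]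
  refine sum_le_sum fun v _ => ?_
  nlinarith [push_nonneg X v, push_le_one hX v]

end Pushforward

section Increment

variable {p : ℕ} [Fact p.Prime]

lemma trilinear_sub_trilinear (T₀ T₁ T₂ : Matrix (Fin 2) (Fin 2) (ZMod p))
    (g h : (Fin 2 → ZMod p) → ℝ) :
    trilinear T₀ T₁ T₂ g g g - trilinear T₀ T₁ T₂ h h h = trilinear T₀ T₁ T₂ (g - h) g g +
      trilinear T₀ T₁ T₂ h (g - h) g + trilinear T₀ T₁ T₂ h h (g - h) := by
  simp only [trilinear, ← sum_add_distrib, ← sum_sub_distrib, Pi.sub_apply]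
  refine sum_congr rfl fun x _ => sum_congr rfl fun y _ => sum_congr rfl fun z _ => ?_
  ring

lemma trilinear_smul (T₀ T₁ T₂ : Matrix (Fin 2) (Fin 2) (ZMod p))
    (c : ℝ) (h : (Fin 2 → ZMod p) → ℝ) :
    trilinear T₀ T₁ T₂ (c • h) (c • h) (c • h) = c ^ 3 * trilinear T₀ T₁ T₂ h h h := by
  simp only [trilinear, mul_sum, Pi.smul_apply, smul_eq_mul]
  refine sum_congr rfl fun x _ => sum_congr rfl fun y _ => sum_congr rfl fun z _ => ?_
  ring

lemma norm_fourier_push_le (X : Finset (Fin 2 → ℤ)) (ξ : Fin 2 → ZMod p) :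
    ‖fourier (push p X) ξ‖ ≤ #X := by
  refine (norm_fourier_le _ _).trans (le_of_eq ?_)
  rw [← sum_push (p := p) X]
  exact sum_congr rfl fun x _ => abs_of_nonneg (push_nonneg X x)

lemma sum_norm_fourier_push_cube_le {X : Finset (Fin 2 → ℤ)}
    (hX : Set.InjOn (red p) (X : Set (Fin 2 → ℤ))) :
    ∑ ξ, ‖fourier (push p X) ξ‖ ^ 3 ≤ (p : ℝ) ^ 2 * (#X : ℝ) ^ 2 := by
  calc ∑ ξ, ‖fourier (push p X) ξ‖ ^ 3 ≤ ∑ ξ, #X * ‖fourier (push p X) ξ‖ ^ 2 := by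
        refine sum_le_sum fun ξ _ => ?_
        rw [pow_succ']
        exact mul_le_mul_of_nonneg_right (norm_fourier_push_le X ξ) (by positivity)
    _ = #X * ((p : ℝ) ^ 2 * ∑ v, push p X v ^ 2) := by rw [← mul_sum, sum_norm_fourier_sq]
    _ ≤ #X * ((p : ℝ) ^ 2 * #X) := by gcongr; exact sum_push_sq_le hX
    _ = _ := by ring

/-- If `A` has far fewer solutions than expected, then its balanced function has a large cubic
Fourier moment. -/
lemma le_sum_norm_fourier_cube {N K : ℕ} (hN : 0 < N) (hNp : N ≤ p) (hpK : p ≤ 2 * K * N)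
    {T₀ T₁ T₂ : Matrix (Fin 2) (Fin 2) (ZMod p)}
    (h₀ : T₀.det ≠ 0) (h₁ : T₁.det ≠ 0) (h₂ : T₂.det ≠ 0) {A : Finset (Fin 2 → ℤ)}
    (htri : trilinear T₀ T₁ T₂ (push p A) (push p A) (push p A) ≤ #A) {c : ℝ}
    (hc : c * (N : ℝ) ^ 4 ≤
      trilinear T₀ T₁ T₂ (push p (box N)) (push p (box N)) (push p (box N)))
    {α τ : ℝ} (hα : 0 < α) (hA : (#A : ℝ) = α * N ^ 2) (hbig : 2 ≤ c * α ^ 2 * N ^ 2)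
    (hτ : 0 < τ) (hτ₁ : τ ≤ 4 * K ^ 2) (hτ₂ : 42 * (4 * (K : ℝ) ^ 2) ^ 2 * τ < c) :
    (τ * (α * N ^ 2)) ^ 3 ≤ ∑ ξ, ‖fourier (push p A - α • push p (box N)) ξ‖ ^ 3 := by
  by_contra! hcon
  set f := push p A - α • push p (box N) with hf
  set β := α • push p (box N) with hβ
  set w : ℝ := α * N ^ 2 with hw
  set b : ℝ := 4 * (K : ℝ) ^ 2 with hb
  have hNpos : (0 : ℝ) < N := Nat.cast_pos.2 hN
  have hwpos : 0 < w := by positivity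
  have hK : 1 ≤ K := by
    rcases Nat.eq_zero_or_pos K with rfl | h
    · simp at hpK; have := (Fact.out : p.Prime).pos; omega
    · exact h
  have hK' : (1 : ℝ) ≤ K := by exact_mod_cast hK
  have hb1 : 1 ≤ b := by nlinarith
  have hpK' : (p : ℝ) ≤ 2 * K * N := by exact_mod_cast hpK
  have hNp' : (N : ℝ) ≤ p := by exact_mod_cast hNp
  have hp2 : (p : ℝ) ^ 2 ≤ b * N ^ 2 := by
    calc (p : ℝ) ^ 2 ≤ (2 * K * N) ^ 2 := by gcongr
      _ = b * N ^ 2 := by rw [hb]; ring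
  have hβ3 : ∑ ξ, ‖fourier β ξ‖ ^ 3 ≤ (b * w) ^ 3 := by
    have h := sum_norm_fourier_push_cube_le (red_injOn_box hNp)
    rw [card_box] at h
    simp only [hβ, fourier_smul, norm_mul, mul_pow, ← mul_sum, Complex.norm_real,
      Real.norm_eq_abs, abs_of_pos hα]
    calc α ^ 3 * ∑ ξ, ‖fourier (push p (box N)) ξ‖ ^ 3
        ≤ α ^ 3 * ((b * N ^ 2) * (N ^ 2) ^ 2) := by
          gcongr
          refine h.trans ?_
          push_cast
          gcongr
      _ = b * w ^ 3 := by rw [hw]; ring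
      _ ≤ b ^ 3 * w ^ 3 := by
          gcongr
          exact le_self_pow₀ hb1 (by norm_num)
  have hA3 : ∑ ξ, ‖fourier (push p A) ξ‖ ^ 3 ≤ (2 * b * w) ^ 3 := by
    have hAf : push p A = f + β := by rw [hf]; abel
    calc ∑ ξ, ‖fourier (push p A) ξ‖ ^ 3
        ≤ ∑ ξ, (4 * ‖fourier f ξ‖ ^ 3 + 4 * ‖fourier β ξ‖ ^ 3) := by
          refine sum_le_sum fun ξ _ => ?_
          rw [hAf, fourier_add]
          refine (pow_le_pow_left₀ (norm_nonneg _) (norm_add_le _ _) 3).trans ?_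
          have hx := norm_nonneg (fourier f ξ)
          have hy := norm_nonneg (fourier β ξ)
          nlinarith [mul_nonneg (add_nonneg hx hy)
            (sq_nonneg (‖fourier f ξ‖ - ‖fourier β ξ‖))]
      _ ≤ 4 * (τ * w) ^ 3 + 4 * (b * w) ^ 3 := by
          rw [sum_add_distrib, ← mul_sum, ← mul_sum]
          gcongr
      _ ≤ 4 * (b * w) ^ 3 + 4 * (b * w) ^ 3 := by gcongr
      _ = (2 * b * w) ^ 3 := by ring
  have e₁ := abs_trilinear_le h₀ h₁ h₂ (mul_pos hτ hwpos) (by positivity) (by positivity)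
    hcon.le hA3 hA3
  have e₂ := abs_trilinear_le h₀ h₁ h₂ (by positivity) (mul_pos hτ hwpos) (by positivity)
    hβ3 hcon.le hA3
  have e₃ := abs_trilinear_le h₀ h₁ h₂ (by positivity) (by positivity) (mul_pos hτ hwpos)
    hβ3 hβ3 hcon.le
  have hsub := trilinear_sub_trilinear T₀ T₁ T₂ (push p A) β
  rw [hβ, trilinear_smul, ← hβ, ← hf] at hsub
  have hcpos : 0 < c := lt_trans (by positivity) hτ₂
  set tA := trilinear T₀ T₁ T₂ (push p A) (push p A) (push p A)
  set tB := trilinear T₀ T₁ T₂ (push p (box N)) (push p (box N)) (push p (box N))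
  have htA : tA ≤ α ^ 3 * c * N ^ 4 / 2 := by
    rw [hA] at htri
    have h := mul_le_mul_of_nonneg_left hbig hwpos.le
    have h' : w * (c * α ^ 2 * N ^ 2) = α ^ 3 * c * N ^ 4 := by rw [hw]; ring
    linarith
  have htB : α ^ 3 * (c * N ^ 4) ≤ α ^ 3 * tB := by gcongr
  have hD : α ^ 3 * c * N ^ 4 / 2 ≤ α ^ 3 * tB - tA := by linarith
  have hlow : w ^ 3 * (c / 2) ≤ (p : ℝ) ^ 2 * (α ^ 3 * tB - tA) := by
    calc w ^ 3 * (c / 2) = (N : ℝ) ^ 2 * (α ^ 3 * c * N ^ 4 / 2) := by rw [hw]; ring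
      _ ≤ _ := by gcongr
  have hupp : (p : ℝ) ^ 2 * (α ^ 3 * tB - tA) ≤ w ^ 3 * (21 * b ^ 2 * τ) := by
    have h : α ^ 3 * tB - tA ≤ |trilinear T₀ T₁ T₂ f (push p A) (push p A)| +
        |trilinear T₀ T₁ T₂ β f (push p A)| + |trilinear T₀ T₁ T₂ β β f| := by
      linarith [neg_abs_le (trilinear T₀ T₁ T₂ f (push p A) (push p A)),
        neg_abs_le (trilinear T₀ T₁ T₂ β f (push p A)), neg_abs_le (trilinear T₀ T₁ T₂ β β f)]
    refine (mul_le_mul_of_nonneg_left h (by positivity)).trans ?_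
    rw [mul_add, mul_add]
    refine (add_le_add (add_le_add e₁ e₂) e₃).trans (le_of_eq ?_)
    ring
  have := le_of_mul_le_mul_left (hlow.trans hupp) (by positivity : 0 < w ^ 3)
  linarith

lemma card_sub_le_card_interior {N m : ℕ} (hm : 2 * m ≤ N) {A : Finset (Fin 2 → ℤ)}
    (hA : A ⊆ box N) :
    (#A : ℝ) - 4 * m * N ≤ #{a ∈ A | ∀ i, (m : ℤ) ≤ a i ∧ a i < (N : ℤ) - m} := by
  classical
  set I : Finset (Fin 2 → ℤ) := Fintype.piFinset fun _ => Ico (m : ℤ) (N - m) with hI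
  have hIc : #I = (N - 2 * m) ^ 2 := by
    rw [hI, Fintype.card_piFinset_const, Int.card_Ico]
    congr 1
    omega
  have hIsub : I ⊆ box N := fun a ha => by
    rw [hI, Fintype.mem_piFinset] at ha
    rw [mem_box]
    intro i
    have := mem_Ico.1 (ha i)
    omega
  have hcover : A ⊆ {a ∈ A | ∀ i, (m : ℤ) ≤ a i ∧ a i < (N : ℤ) - m} ∪ (box N \ I) := by
    intro a ha
    rw [mem_union, mem_filter, mem_sdiff, hI, Fintype.mem_piFinset]
    by_cases h : ∀ i, (m : ℤ) ≤ a i ∧ a i < (N : ℤ) - m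
    · exact Or.inl ⟨ha, h⟩
    · exact Or.inr ⟨hA ha, fun h' => h fun i => mem_Ico.1 (h' i)⟩
  have h1 := (card_le_card hcover).trans (card_union_le _ _)
  rw [card_sdiff_of_subset hIsub, card_box, hIc] at h1
  have h2 : (N - 2 * m) ^ 2 ≤ N ^ 2 := Nat.pow_le_pow_left (Nat.sub_le _ _) 2
  have h3 : (#A : ℝ) ≤ #{a ∈ A | ∀ i, (m : ℤ) ≤ a i ∧ a i < (N : ℤ) - m} +
      ((N : ℝ) ^ 2 - (N - 2 * m) ^ 2) := by
    have : (((N ^ 2 - (N - 2 * m) ^ 2 : ℕ)) : ℝ) = (N : ℝ) ^ 2 - (N - 2 * m) ^ 2 := by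
      push_cast [Nat.cast_sub h2, Nat.cast_sub hm]
      ring
    rw [← this]
    exact_mod_cast h1
  nlinarith [sq_nonneg (m : ℝ)]

/-- The `L²` density increment: if the Fourier mass of the balanced function on a set `S` of
frequencies is large and the grid `q • [0, L)²` is almost constant on `S`, then `A` is denser on a
translate of this grid. -/
lemma exists_dense_shift {N K q L : ℕ} (hN : 0 < N) (hK : 0 < K) (hL : 0 < L) (hNp : N ≤ p)
    (hpK : p ≤ 2 * K * N) {A : Finset (Fin 2 → ℤ)} (hAN : A ⊆ box N) {α : ℝ} (hα : 0 < α)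
    (hA : (#A : ℝ) = α * N ^ 2) {S : Finset (Fin 2 → ZMod p)}
    (hS : ∀ ξ ∈ S, (L : ℝ) ^ 2 / 2 ≤
      ‖∑ u ∈ box L, (starRingEnd ℂ) (ZMod.stdAddChar (ξ ⬝ᵥ red p ((q : ℤ) • u)))‖) {E : ℝ}
    (hE : E * (2 * (α * N ^ 2)) ^ 2 ≤
      ∑ ξ ∈ S, ‖fourier (push p A - α • push p (box N)) ξ‖ ^ 2)
    (hqL : 2 * (q * L) ≤ N) (hqLE : 64 * (K : ℝ) ^ 2 * (q * L) ≤ α * N * E) :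
    ∃ x, (L : ℝ) ^ 2 * (α * (1 + E / (8 * K ^ 2))) ≤
      shiftSum (box L) (fun u => red p ((q : ℤ) • u)) (push p A) x := by
  set s : (Fin 2 → ℤ) → Fin 2 → ZMod p := fun u => red p ((q : ℤ) • u) with hs
  set f := push p A - α • push p (box N) with hf
  set WA := shiftSum (box L) s (push p A) with hWA
  set WB := shiftSum (box L) s (push p (box N)) with hWB
  have hNpos : (0 : ℝ) < N := Nat.cast_pos.2 hN
  have hLpos : (0 : ℝ) < L := Nat.cast_pos.2 hL
  have hKpos : (0 : ℝ) < K := Nat.cast_pos.2 hK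
  have hp0 : (0 : ℝ) < p := Nat.cast_pos.2 (Fact.out : p.Prime).pos
  have hpK' : (p : ℝ) ≤ 2 * K * N := by exact_mod_cast hpK
  have hWf : ∀ x, shiftSum (box L) s f x = WA x - α * WB x := fun x => by
    simp [hWA, hWB, shiftSum, hf, sum_sub_distrib, mul_sum]
  have hWA0 : ∀ x, 0 ≤ WA x := fun x => sum_nonneg fun u _ => push_nonneg _ _
  have hWB0 : ∀ x, 0 ≤ WB x := fun x => sum_nonneg fun u _ => push_nonneg _ _
  have hsumA : ∑ x, WA x = L ^ 2 * (α * N ^ 2) := by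
    rw [hWA, sum_shiftSum, sum_push, hA, card_box]; push_cast; ring
  have hsumB : ∑ x, WB x = L ^ 2 * N ^ 2 := by
    rw [hWB, sum_shiftSum, sum_push, card_box, card_box]; push_cast; ring
  have hBB : ∑ x, WB x ^ 2 ≤ L ^ 4 * N ^ 2 := by
    have hWB1 : ∀ x, WB x ≤ L ^ 2 := fun x => by
      refine (sum_le_card_nsmul _ _ 1 fun u _ => push_le_one (red_injOn_box hNp) _).trans ?_
      simp [card_box]
    calc ∑ x, WB x ^ 2 ≤ ∑ x, (L : ℝ) ^ 2 * WB x := by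
          refine sum_le_sum fun x _ => ?_
          rw [sq (WB x)]
          exact mul_le_mul_of_nonneg_right (hWB1 x) (hWB0 x)
      _ = L ^ 4 * N ^ 2 := by rw [← mul_sum, hsumB]; ring
  have hAB : L ^ 4 * (α * N ^ 2 - 4 * (q * L) * N) ≤ ∑ x, WA x * WB x := by
    set I := {a ∈ A | ∀ i, ((q * L : ℕ) : ℤ) ≤ a i ∧ a i < (N : ℤ) - (q * L : ℕ)} with hI
    have hint := card_sub_le_card_interior (m := q * L) hqL hAN
    rw [← hI, hA] at hint
    have hWBI : ∀ a ∈ I, ∀ u ∈ box L, (L : ℝ) ^ 2 ≤ WB (red p a - s u) := by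
      intro a ha u hu
      have hcard : (L : ℝ) ^ 2 = #(box L) • (1 : ℝ) := by simp [card_box]
      rw [hcard]
      refine card_nsmul_le_sum _ _ _ fun v hv => ?_
      rw [hs, ← red_sub, ← red_add]
      refine one_le_push (mem_box.2 fun i => ?_)
      have h1 := (mem_filter.1 ha).2 i
      have h2 := mem_box.1 hu i
      have h3 := mem_box.1 hv i
      simp only [Pi.add_apply, Pi.sub_apply, Pi.smul_apply, smul_eq_mul]
      push_cast at h1
      have hq : (0 : ℤ) ≤ q := Int.natCast_nonneg q
      have h4 := mul_le_mul_of_nonneg_left h2.2.le hq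
      have h5 := mul_le_mul_of_nonneg_left h3.2.le hq
      have h6 := mul_nonneg hq h2.1
      have h7 := mul_nonneg hq h3.1
      constructor <;> linarith
    have hswap : ∑ x, WA x * WB x = ∑ u ∈ box L, ∑ a ∈ A, WB (red p a - s u) := by
      simp only [hWA]
      simp only [shiftSum, sum_mul]
      rw [sum_comm]
      refine sum_congr rfl fun u _ => ?_
      rw [← sum_push_mul A fun v => WB (v - s u)]
      exact Fintype.sum_equiv (Equiv.addRight (s u)) _ _ fun x => by simp
    rw [hswap]
    calc (L : ℝ) ^ 4 * (α * N ^ 2 - 4 * (q * L) * N) ≤ L ^ 4 * #I := by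
          gcongr
          push_cast at hint
          exact hint
      _ = ∑ u ∈ box L, ∑ a ∈ I, (L : ℝ) ^ 2 := by
          simp only [sum_const, card_box, nsmul_eq_mul]; push_cast; ring
      _ ≤ ∑ u ∈ box L, ∑ a ∈ A, WB (red p a - s u) := by
          refine sum_le_sum fun u hu => (sum_le_sum fun a ha => hWBI a ha u hu).trans ?_
          exact sum_le_sum_of_subset_of_nonneg (filter_subset _ _) fun a _ _ => hWB0 _
  have hff : L ^ 4 * (α ^ 2 * N ^ 2) * (E / (4 * K ^ 2)) ≤ ∑ x, (WA x - α * WB x) ^ 2 := by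
    have hpars := sum_norm_fourier_sq (shiftSum (box L) s f)
    simp only [hWf] at hpars
    have hlow : E * (2 * (α * N ^ 2)) ^ 2 * (L ^ 2 / 2) ^ 2 ≤
        ∑ ξ, ‖fourier (shiftSum (box L) s f) ξ‖ ^ 2 := by
      calc E * (2 * (α * N ^ 2)) ^ 2 * ((L : ℝ) ^ 2 / 2) ^ 2
          ≤ (∑ ξ ∈ S, ‖fourier f ξ‖ ^ 2) * ((L : ℝ) ^ 2 / 2) ^ 2 := by gcongr
        _ ≤ ∑ ξ ∈ S, ‖fourier (shiftSum (box L) s f) ξ‖ ^ 2 := by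
            rw [sum_mul]
            refine sum_le_sum fun ξ hξ => ?_
            rw [fourier_shiftSum, norm_mul, mul_pow]
            gcongr
            exact hS ξ hξ
        _ ≤ _ := sum_le_sum_of_subset_of_nonneg (subset_univ S) fun ξ _ _ => by positivity
    rw [hpars] at hlow
    have hE0 : 0 ≤ E := by
      have : 0 ≤ α * N * E := le_trans (by positivity) hqLE
      exact nonneg_of_mul_nonneg_right this (by positivity)
    refine le_of_mul_le_mul_left (a := (p : ℝ) ^ 2) (le_trans ?_ hlow) (by positivity)
    calc (p : ℝ) ^ 2 * (L ^ 4 * (α ^ 2 * N ^ 2) * (E / (4 * K ^ 2)))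
        ≤ (2 * K * N) ^ 2 * (L ^ 4 * (α ^ 2 * N ^ 2) * (E / (4 * K ^ 2))) := by gcongr
      _ = _ := by field_simp; ring
  have hAA : ∑ x, WA x ^ 2 = ∑ x, (WA x - α * WB x) ^ 2 + 2 * α * ∑ x, WA x * WB x
      - α ^ 2 * ∑ x, WB x ^ 2 := by
    simp only [mul_sum, ← sum_add_distrib, ← sum_sub_distrib]
    exact sum_congr rfl fun x _ => by ring
  obtain ⟨x, hx⟩ := Finite.exists_max WA
  refine ⟨x, ?_⟩
  have hupp : ∑ y, WA y ^ 2 ≤ WA x * (L ^ 2 * (α * N ^ 2)) := by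
    rw [← hsumA, mul_sum]
    refine sum_le_sum fun y _ => ?_
    rw [sq]
    exact mul_le_mul_of_nonneg_right (hx y) (hWA0 y)
  have hlow : (L : ℝ) ^ 2 * (α * (1 + E / (8 * K ^ 2))) * (L ^ 2 * (α * N ^ 2)) ≤
      ∑ y, WA y ^ 2 := by
    have h1 := mul_le_mul_of_nonneg_left hAB (by positivity : 0 ≤ 2 * α)
    have h2 := mul_le_mul_of_nonneg_left hBB (by positivity : 0 ≤ α ^ 2)
    have h3 : 8 * α * L ^ 4 * (q * L) * N ≤ L ^ 4 * (α ^ 2 * N ^ 2) * (E / (8 * K ^ 2)) := by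
      have := mul_le_mul_of_nonneg_left hqLE
        (by positivity : 0 ≤ (L : ℝ) ^ 4 * α * N / (8 * K ^ 2))
      calc _ = (L : ℝ) ^ 4 * α * N / (8 * K ^ 2) * (64 * K ^ 2 * (q * L)) := by field_simp; ring
        _ ≤ _ := this
        _ = _ := by ring
    have h4 : (L : ℝ) ^ 4 * (α ^ 2 * N ^ 2) * (E / (4 * K ^ 2)) =
        2 * (L ^ 4 * (α ^ 2 * N ^ 2) * (E / (8 * K ^ 2))) := by field_simp; ring
    rw [hAA]
    linarith
  exact le_of_mul_le_mul_right (hlow.trans hupp) (by positivity)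

end Increment

section Iteration

lemma sq_div_two_le_norm_sum {p : ℕ} [Fact p.Prime] {q L : ℕ} {ξ : Fin 2 → ZMod p}
    (h : ∀ i, ∃ r : ℤ, |r| * (12 * L : ℕ) ≤ p ∧ (q : ZMod p) * ξ i = r) :
    (L : ℝ) ^ 2 / 2 ≤
      ‖∑ u ∈ box L, (starRingEnd ℂ) (ZMod.stdAddChar (ξ ⬝ᵥ red p ((q : ℤ) • u)))‖ := by
  choose r hr hr' using h
  refine le_trans ?_ (Complex.re_le_norm _)
  rw [Complex.re_sum]
  have hcard : (L : ℝ) ^ 2 / 2 = #(box L) • (1 / 2 : ℝ) := by simp [card_box]; ring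
  rw [hcard]
  refine card_nsmul_le_sum _ _ _ fun u hu => ?_
  rw [Complex.conj_re]
  have hphase : ξ ⬝ᵥ red p ((q : ℤ) • u) = ((r 0 * u 0 + r 1 * u 1 : ℤ) : ZMod p) := by
    push_cast
    rw [← hr' 0, ← hr' 1, dotProduct, Fin.sum_univ_two]
    simp only [red, Pi.smul_apply, smul_eq_mul]
    push_cast
    ring
  rw [hphase]
  apply half_le_re_stdAddChar
  rw [mem_box] at hu
  have hterm : ∀ i, |r i * u i| ≤ |r i| * L := fun i => by
    rw [abs_mul, abs_of_nonneg (hu i).1]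
    exact mul_le_mul_of_nonneg_left (hu i).2.le (abs_nonneg _)
  have h0 := hr 0
  have h1 := hr 1
  push_cast at h0 h1
  linarith [abs_add_le (r 0 * u 0) (r 1 * u 1), hterm 0, hterm 1]

lemma exists_nat_root {N Q m : ℕ} (hm : m ≠ 0) (hQ : Q ^ m ≤ N) :
    ∃ L, Q ≤ L ∧ L ^ m ≤ N ∧ N < (L + 1) ^ m := by
  have hle : ∀ L, L ^ m ≤ N → L ≤ N := fun L h => (Nat.le_self_pow hm L).trans h
  refine ⟨Nat.findGreatest (fun L => L ^ m ≤ N) N, Nat.le_findGreatest (hle Q hQ) hQ,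
    Nat.findGreatest_spec (P := fun L => L ^ m ≤ N) (hle Q hQ) hQ, ?_⟩
  by_contra! h
  have := Nat.le_findGreatest (P := fun L => L ^ m ≤ N) (hle _ h) h
  omega

/-- Sets in which every solution of `T₀ a + T₁ b + T₂ c = 0` is degenerate. -/
def SolutionFree (T₀ T₁ T₂ : Matrix (Fin 2) (Fin 2) ℤ) (A : Finset (Fin 2 → ℤ)) : Prop :=
  ∀ a ∈ A, ∀ b ∈ A, ∀ c ∈ A, T₀ *ᵥ a + T₁ *ᵥ b + T₂ *ᵥ c = 0 → a = b

variable {T₀ T₁ T₂ : Matrix (Fin 2) (Fin 2) ℤ}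

lemma eq_zero_of_red_combination {p N : ℕ}
    (hp : (entrySum T₀ + entrySum T₁ + entrySum T₂) * N < p) {a b c : Fin 2 → ℤ}
    (ha : a ∈ box N) (hb : b ∈ box N) (hc : c ∈ box N)
    (h : red p (T₀ *ᵥ a + T₁ *ᵥ b + T₂ *ᵥ c) = 0) : T₀ *ᵥ a + T₁ *ᵥ b + T₂ *ᵥ c = 0 := by
  refine eq_zero_of_red_eq_zero h fun i => ?_
  have habs : ∀ {x}, x ∈ box N → ∀ i, |x i| ≤ (N : ℤ) := fun hx i => by
    have := mem_box.1 hx i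
    rw [abs_of_nonneg this.1]
    exact this.2.le
  have h0 := abs_mulVec_le T₀ (habs ha) i
  have h1 := abs_mulVec_le T₁ (habs hb) i
  have h2 := abs_mulVec_le T₂ (habs hc) i
  have hp' : ((entrySum T₀ + entrySum T₁ + entrySum T₂ : ℤ)) * N < p := by exact_mod_cast hp
  simp only [Pi.add_apply]
  have h3 := abs_add_le ((T₀ *ᵥ a) i + (T₁ *ᵥ b) i) ((T₂ *ᵥ c) i)
  have h4 := abs_add_le ((T₀ *ᵥ a) i) ((T₁ *ᵥ b) i)
  linarith

lemma SolutionFree.card_solutions_le {p N : ℕ} (hsum : T₀ + T₁ + T₂ = 0) (h₂ : T₂.det ≠ 0)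
    (hp : (entrySum T₀ + entrySum T₁ + entrySum T₂) * N < p) {A : Finset (Fin 2 → ℤ)}
    (hA : A ⊆ box N) (hfree : SolutionFree T₀ T₁ T₂ A) :
    #{t ∈ A ×ˢ A ×ˢ A | red p (T₀ *ᵥ t.1 + T₁ *ᵥ t.2.1 + T₂ *ᵥ t.2.2) = 0} ≤ #A := by
  have hdiag : ∀ t ∈ ({t ∈ A ×ˢ A ×ˢ A | red p (T₀ *ᵥ t.1 + T₁ *ᵥ t.2.1 + T₂ *ᵥ t.2.2) = 0} :
      Finset _), t.1 ∈ A ∧ t = (t.1, t.1, t.1) := by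
    rintro ⟨a, b, c⟩ ht
    simp only [mem_filter, mem_product] at ht
    obtain ⟨⟨ha, hb, hc⟩, ht⟩ := ht
    have h := eq_zero_of_red_combination hp (hA ha) (hA hb) (hA hc) ht
    obtain rfl := hfree a ha b hb c hc h
    have hca : c = a := by
      apply mulVec_injective_of_det_ne_zero h₂
      rw [← add_mulVec, eq_neg_of_add_eq_zero_left hsum, neg_mulVec, neg_add_eq_zero] at h
      exact h.symm
    simp [ha, hca]
  refine card_le_card_of_injOn Prod.fst (fun t ht => (hdiag t ht).1) fun t ht t' ht' h => ?_
  rw [(hdiag t ht).2, (hdiag t' ht').2, h]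

/-- Pulling back a solution-free set along a dilate modulo `p` gives a solution-free set. -/
lemma SolutionFree.pullback {p N q L : ℕ} [Fact p.Prime] (hsum : T₀ + T₁ + T₂ = 0)
    (hp : (entrySum T₀ + entrySum T₁ + entrySum T₂) * N < p) {A : Finset (Fin 2 → ℤ)}
    (hA : A ⊆ box N) (hfree : SolutionFree T₀ T₁ T₂ A) (hq : 0 < q) (hqL : q * L < p)
    (x : Fin 2 → ZMod p) {A' : Finset (Fin 2 → ℤ)} (hA' : A' ⊆ box L)
    (hx : ∀ u ∈ A', ∃ a ∈ A, red p a = x + red p ((q : ℤ) • u)) : SolutionFree T₀ T₁ T₂ A' := by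
  intro u₀ hu₀ u₁ hu₁ u₂ hu₂ h
  obtain ⟨a₀, ha₀, e₀⟩ := hx u₀ hu₀
  obtain ⟨a₁, ha₁, e₁⟩ := hx u₁ hu₁
  obtain ⟨a₂, ha₂, e₂⟩ := hx u₂ hu₂
  have hred : red p (T₀ *ᵥ a₀ + T₁ *ᵥ a₁ + T₂ *ᵥ a₂) = 0 := by
    have hx0 : T₀.map (Int.castRingHom (ZMod p)) *ᵥ x + T₁.map (Int.castRingHom (ZMod p)) *ᵥ x +
        T₂.map (Int.castRingHom (ZMod p)) *ᵥ x = 0 := by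
      rw [← add_mulVec, ← add_mulVec, ← Matrix.map_add _ (map_add _), ← Matrix.map_add _ (map_add _),
        hsum, Matrix.map_zero _ (map_zero _), zero_mulVec]
    have hu : red p (T₀ *ᵥ ((q : ℤ) • u₀)) + red p (T₁ *ᵥ ((q : ℤ) • u₁)) +
        red p (T₂ *ᵥ ((q : ℤ) • u₂)) = 0 := by
      rw [← red_add, ← red_add, mulVec_smul, mulVec_smul, mulVec_smul, ← smul_add, ← smul_add, h]
      funext i
      simp [red]
    rw [red_add, red_add, red_mulVec, red_mulVec, red_mulVec, e₀, e₁, e₂, mulVec_add, mulVec_add,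
      mulVec_add, ← red_mulVec, ← red_mulVec, ← red_mulVec]
    linear_combination hx0 + hu
  have ha := hfree a₀ ha₀ a₁ ha₁ a₂ ha₂
    (eq_zero_of_red_combination hp (hA ha₀) (hA ha₁) (hA ha₂) hred)
  rw [ha, e₁, add_right_inj] at e₀
  have hz : (q : ℤ) • u₁ - (q : ℤ) • u₀ = 0 := by
    refine eq_zero_of_red_eq_zero (p := p) (by rw [red_sub, e₀, sub_self]) fun i => ?_
    have h0 := mem_box.1 (hA' hu₀) i
    have h1 := mem_box.1 (hA' hu₁) i
    have hqL' : (q : ℤ) * L < p := by exact_mod_cast hqL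
    have hq' : (0 : ℤ) < q := by exact_mod_cast hq
    simp only [Pi.sub_apply, Pi.smul_apply, smul_eq_mul]
    rw [← mul_sub, abs_mul, abs_of_pos hq']
    refine lt_of_le_of_lt (mul_le_mul_of_nonneg_left ?_ hq'.le) hqL'
    rw [abs_le]
    constructor <;> linarith
  rw [← smul_sub, smul_eq_zero] at hz
  rcases hz with hz | hz
  · omega
  · exact (sub_eq_zero.1 hz).symm

end Iteration

section Spectrum

variable {p : ℕ} [Fact p.Prime]

/-- If the balanced function of `A` has large Fourier coefficients in `L³`, then there is a set of
frequencies whose total energy is large in comparison with its size. -/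
lemma exists_large_spectrum {N K : ℕ} (hN : 0 < N) (hNp : N ≤ p) (hpK : p ≤ 2 * K * N)
    {A : Finset (Fin 2 → ℤ)} (hAN : A ⊆ box N) {α τ : ℝ} (hα : 0 < α) (hα₁ : α ≤ 1)
    (hA : (#A : ℝ) = α * N ^ 2) (hτ : 0 < τ)
    (hcube : (τ * (α * N ^ 2)) ^ 3 ≤ ∑ ξ, ‖fourier (push p A - α • push p (box N)) ξ‖ ^ 3) :
    ∃ S : Finset (Fin 2 → ZMod p), S.Nonempty ∧ ∃ E : ℝ, 0 ≤ E ∧ E * α ≤ 2 * K ^ 2 ∧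
      #S * ((τ ^ 3 / 16) ^ 4 / 2 ^ 20) ≤ E ^ 5 ∧
      E * (2 * (α * N ^ 2)) ^ 2 ≤
        ∑ ξ ∈ S, ‖fourier (push p A - α • push p (box N)) ξ‖ ^ 2 := by
  set f := push p A - α • push p (box N) with hf
  have hNR : (0 : ℝ) < N := Nat.cast_pos.2 hN
  set R : ℝ := 2 * (α * N ^ 2) with hR
  have hRpos : 0 < R := by positivity
  have hinj := red_injOn_box hNp
  have hinjA : Set.InjOn (red p) (A : Set (Fin 2 → ℤ)) := hinj.mono (by exact_mod_cast hAN)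
  have hle : ∀ ξ, ‖fourier f ξ‖ ≤ R := fun ξ => by
    have hsplit : f = push p A + (-α) • push p (box N) := by
      rw [hf, neg_smul, sub_eq_add_neg]
    have hbox : ‖fourier (push p (box N)) ξ‖ ≤ (N : ℝ) ^ 2 := by
      have := norm_fourier_push_le (p := p) (box N) ξ
      rwa [card_box, Nat.cast_pow] at this
    rw [hsplit, fourier_add, fourier_smul]
    refine (norm_add_le _ _).trans ?_
    rw [norm_mul, Complex.norm_real, Real.norm_eq_abs, abs_neg, abs_of_pos hα]
    have h1 := norm_fourier_push_le (p := p) A ξ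
    rw [hA] at h1
    have h2 := mul_le_mul_of_nonneg_left hbox hα.le
    linarith
  obtain ⟨S, hS, hSE⟩ := exists_level_set (fun ξ => ‖fourier f ξ‖ / R) (fun ξ => by positivity)
    (fun ξ => div_le_one_of_le₀ (hle ξ) hRpos.le) (δ := τ ^ 3 / 16) (by positivity) (by
      simp only [div_pow]
      rw [← sum_div, le_div_iff₀ (by positivity)]
      refine le_trans (le_of_eq ?_) hcube
      rw [hR]; ring)
  simp only [div_pow] at hSE
  rw [← sum_div] at hSE
  refine ⟨S, hS, (∑ ξ ∈ S, ‖fourier f ξ‖ ^ 2) / R ^ 2, by positivity, ?_,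
    by simpa [div_pow] using hSE, ?_⟩
  · have hpars : ∑ ξ ∈ S, ‖fourier f ξ‖ ^ 2 ≤ (p : ℝ) ^ 2 * ∑ x, f x ^ 2 := by
      rw [← sum_norm_fourier_sq]
      exact sum_le_sum_of_subset_of_nonneg (subset_univ _) fun _ _ _ => by positivity
    have hsq : ∑ x, f x ^ 2 ≤ 2 * (α * N ^ 2) := by
      have hpt : ∀ x, f x ^ 2 ≤ push p A x ^ 2 + α ^ 2 * push p (box N) x ^ 2 := fun x => by
        have : 0 ≤ push p A x * (α * push p (box N) x) :=
          mul_nonneg (push_nonneg _ _) (mul_nonneg hα.le (push_nonneg _ _))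
        simp only [hf, Pi.sub_apply, Pi.smul_apply, smul_eq_mul]
        nlinarith
      refine (sum_le_sum fun x _ => hpt x).trans ?_
      rw [sum_add_distrib, ← mul_sum]
      have h1 := sum_push_sq_le hinjA
      have h2 := sum_push_sq_le hinj
      rw [card_box, Nat.cast_pow] at h2
      rw [hA] at h1
      have h3 := mul_le_mul_of_nonneg_left h2 (sq_nonneg α)
      have h4 : α ^ 2 * (N : ℝ) ^ 2 ≤ α * N ^ 2 := by
        refine mul_le_mul_of_nonneg_right ?_ (by positivity)
        nlinarith
      linarith
    have hp : (p : ℝ) ^ 2 ≤ (2 * K * N) ^ 2 := by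
      have : (p : ℝ) ≤ 2 * K * N := by exact_mod_cast hpK
      gcongr
    have hS2 : ∑ ξ ∈ S, ‖fourier f ξ‖ ^ 2 ≤ (2 * K * N) ^ 2 * (2 * (α * N ^ 2)) :=
      hpars.trans (mul_le_mul hp hsq (sum_nonneg fun _ _ => sq_nonneg _) (by positivity))
    rw [div_mul_eq_mul_div, div_le_iff₀ (by positivity)]
    refine (mul_le_mul_of_nonneg_right hS2 hα.le).trans (le_of_eq ?_)
    rw [hR]; ring
  · rw [div_mul_cancel₀ _ (by positivity)]

end Spectrum

lemma exists_scale {K k N : ℕ} (hK : 0 < K) (hk : 0 < k) {α σ E : ℝ} (hα : 0 < α) (hα₁ : α ≤ 1)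
    (hσ : 0 < σ) (hσ₁ : σ ≤ 1) (hσE : σ ≤ E) (hEα : E * α ≤ 2 * K ^ 2)
    (hlog : 8 * k * (65 * K ^ 2 / (α * σ)) ≤ Real.log N) :
    ∃ L : ℕ, 0 < L ∧ L < N ∧ Real.log N ≤ 16 * k * Real.log L ∧
      ∀ q : ℕ, q ≤ (12 * L) ^ (2 * k) →
        2 * (q * L) ≤ N ∧ 64 * (K : ℝ) ^ 2 * (q * L) ≤ α * N * E := by
  have hKR : (1 : ℝ) ≤ K := by exact_mod_cast hK
  have hkR : (1 : ℝ) ≤ k := by exact_mod_cast hk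
  have hασ : 0 < α * σ := by positivity
  have hασ₁ : α * σ ≤ 1 := mul_le_one₀ hα₁ hσ.le hσ₁
  have hbase : 1 ≤ (K : ℝ) ^ 2 / (α * σ) := by
    rw [le_div_iff₀ hασ, one_mul]
    exact hασ₁.trans (one_le_pow₀ hKR)
  set Q : ℕ := ⌈64 * (K : ℝ) ^ 2 / (α * σ)⌉₊ with hQ
  have hQle : 64 * (K : ℝ) ^ 2 / (α * σ) ≤ Q := Nat.le_ceil _
  have hQge : (Q : ℝ) ≤ 65 * K ^ 2 / (α * σ) := by
    have := (Nat.ceil_lt_add_one (a := 64 * (K : ℝ) ^ 2 / (α * σ)) (by positivity)).le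
    rw [← hQ, mul_div_assoc] at this
    rw [mul_div_assoc]
    linarith
  have hQ64 : 64 ≤ Q := by
    have : (64 : ℝ) ≤ Q := by rw [mul_div_assoc] at hQle; linarith
    exact_mod_cast this
  have hlogpos : 0 < Real.log N := lt_of_lt_of_le (by positivity) hlog
  have hN : 0 < N := by
    rcases Nat.eq_zero_or_pos N with h | h
    · simp [h] at hlogpos
    · exact h
  have hNR : (0 : ℝ) < N := Nat.cast_pos.2 hN
  have hQR : (0 : ℝ) < Q := by positivity
  have hQN : Q ^ (8 * k) ≤ N := by
    have : ((Q : ℝ) ^ (8 * k)) ≤ N := by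
      rw [← Real.log_le_log_iff (by positivity) hNR, Real.log_pow]
      refine le_trans ?_ hlog
      push_cast
      refine mul_le_mul_of_nonneg_left ?_ (by positivity)
      exact ((Real.log_le_sub_one_of_pos hQR).trans (by linarith)).trans hQge
    exact_mod_cast this
  obtain ⟨L, hQL, hLN, hNL⟩ := exists_nat_root (by omega : 8 * k ≠ 0) hQN
  have hL64 : 64 ≤ L := hQ64.trans hQL
  have hLpos : (0 : ℝ) < L := by positivity
  refine ⟨L, by omega, lt_of_lt_of_le ?_ hLN, ?_, fun q hq => ?_⟩
  · exact lt_self_pow₀ (by omega) (by omega)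
  · have h1 : N ≤ L ^ (16 * k) := by
      refine hNL.le.trans ((Nat.pow_le_pow_left (by nlinarith : L + 1 ≤ L ^ 2) _).trans ?_)
      rw [← pow_mul]
      exact le_of_eq (by ring)
    have h2 : (N : ℝ) ≤ (L : ℝ) ^ (16 * k) := by exact_mod_cast h1
    have h3 := Real.log_le_log hNR h2
    rw [Real.log_pow] at h3
    exact_mod_cast h3
  · have hqL : q * L * L ≤ N := by
      calc q * L * L ≤ (L ^ 2) ^ (2 * k) * L * L := by
            gcongr
            exact hq.trans (Nat.pow_le_pow_left (by nlinarith) _)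
        _ = L ^ (4 * k + 2) := by ring
        _ ≤ L ^ (8 * k) := Nat.pow_le_pow_right (by omega) (by omega)
        _ ≤ N := hLN
    have hqLR : (q : ℝ) * L * L ≤ N := by exact_mod_cast hqL
    have hmain : 64 * (K : ℝ) ^ 2 * (q * L) ≤ α * N * E := by
      have h1 : 64 * (K : ℝ) ^ 2 ≤ L * (α * σ) := by
        rw [← div_le_iff₀ hασ]
        exact hQle.trans (by exact_mod_cast hQL)
      calc 64 * (K : ℝ) ^ 2 * (q * L) ≤ L * (α * σ) * (q * L) := by gcongr
        _ = α * (q * L * L) * σ := by ring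
        _ ≤ α * N * E := by gcongr
    refine ⟨?_, hmain⟩
    have hq2 : (K : ℝ) ^ 2 * (2 * (q * L)) ≤ K ^ 2 * N := by
      have : (K : ℝ) ^ 2 * (q * L) ≥ 0 := by positivity
      have h2 : α * N * E ≤ 2 * K ^ 2 * N := by nlinarith
      nlinarith
    have := le_of_mul_le_mul_left hq2 (by positivity)
    exact_mod_cast this

lemma det_map_ne_zero {p : ℕ} {T : Matrix (Fin 2) (Fin 2) ℤ} (hT : T.det ≠ 0)
    (hp : T.det.natAbs < p) : (T.map (Int.castRingHom (ZMod p))).det ≠ 0 := by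
  have h : (T.map (Int.castRingHom (ZMod p))).det = ((T.det : ℤ) : ZMod p) :=
    (RingHom.map_det (Int.castRingHom (ZMod p)) T).symm
  rw [h, Ne, ZMod.intCast_zmod_eq_zero_iff_dvd]
  intro hdvd
  exact hT (Int.eq_zero_of_abs_lt_dvd hdvd (by rw [Int.abs_eq_natAbs]; exact_mod_cast hp))

section Increment

variable {T₀ T₁ T₂ : Matrix (Fin 2) (Fin 2) ℤ}

lemma SolutionFree.exists_dense_box {p N K q L : ℕ} [Fact p.Prime] (hsum : T₀ + T₁ + T₂ = 0)
    (hN : 0 < N) (hK : 0 < K) (hL : 0 < L) (hNp : N ≤ p) (hpK : p ≤ 2 * K * N)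
    (hp : (entrySum T₀ + entrySum T₁ + entrySum T₂) * N < p) {A : Finset (Fin 2 → ℤ)}
    (hAN : A ⊆ box N) (hfree : SolutionFree T₀ T₁ T₂ A) {α : ℝ} (hα : 0 < α)
    (hA : (#A : ℝ) = α * N ^ 2) {S : Finset (Fin 2 → ZMod p)} {E : ℝ}
    (hE : E * (2 * (α * N ^ 2)) ^ 2 ≤
      ∑ ξ ∈ S, ‖fourier (push p A - α • push p (box N)) ξ‖ ^ 2) (hq : 0 < q)
    (hS : ∀ ξ ∈ S, ∀ i, ∃ r : ℤ, |r| * (12 * L : ℕ) ≤ p ∧ (q : ZMod p) * ξ i = r)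
    (hqL : 2 * (q * L) ≤ N) (hqLE : 64 * (K : ℝ) ^ 2 * (q * L) ≤ α * N * E) :
    ∃ A' ⊆ box L, SolutionFree T₀ T₁ T₂ A' ∧
      α * (1 + E / (8 * K ^ 2)) * L ^ 2 ≤ #A' := by
  classical
  obtain ⟨x, hx⟩ := exists_dense_shift hN hK hL hNp hpK hAN hα hA
    (fun ξ hξ => sq_div_two_le_norm_sum (hS ξ hξ)) hE hqL hqLE
  refine ⟨{u ∈ box L | ∃ a ∈ A, red p a = x + red p ((q : ℤ) • u)}, filter_subset _ _,
    hfree.pullback hsum hp hAN hq (by omega) x (filter_subset _ _)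
      fun u hu => (mem_filter.1 hu).2, ?_⟩
  have hinjA : Set.InjOn (red p) (A : Set (Fin 2 → ℤ)) :=
    (red_injOn_box hNp).mono (by exact_mod_cast hAN)
  rw [mul_comm]
  refine hx.trans ?_
  rw [shiftSum, card_filter, Nat.cast_sum]
  refine sum_le_sum fun u _ => ?_
  split_ifs with h
  · exact_mod_cast push_le_one hinjA _
  · rw [Nat.cast_zero]
    by_contra hne
    exact h (exists_mem_of_push_ne_zero (by linarith))

/-- A solution-free subset of a box has, on a dense enough subgrid, a solution-free pullback of
larger density; the loss in `log N` is polynomial in the density gain. -/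
lemma exists_increment (hsum : T₀ + T₁ + T₂ = 0) (h₀ : T₀.det ≠ 0) (h₁ : T₁.det ≠ 0)
    (h₂ : T₂.det ≠ 0) :
    ∃ η C₁ C : ℝ, 0 < η ∧ 0 < C₁ ∧ 0 < C ∧ ∀ (N : ℕ) (A : Finset (Fin 2 → ℤ)), A ⊆ box N →
      SolutionFree T₀ T₁ T₂ A → ∀ α : ℝ, 0 < α → α ≤ 1 → (#A : ℝ) = α * N ^ 2 →
      C ≤ Real.log N * α ^ 6 → ∃ x : ℝ, 1 + η ≤ x ∧ ∃ L : ℕ, 0 < L ∧ L < N ∧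
        ∃ A' ⊆ box L, SolutionFree T₀ T₁ T₂ A' ∧ α * x * L ^ 2 ≤ #A' ∧
          Real.log N ≤ C₁ * x ^ 5 * Real.log L := by
  obtain ⟨c, hc, hc₁, N₁, hbox⟩ := exists_box_solutions T₀ T₁ T₂ hsum h₁
  set K : ℕ := entrySum T₀ + entrySum T₁ + entrySum T₂ +
    (T₀.det.natAbs + T₁.det.natAbs + T₂.det.natAbs) + 1 with hKdef
  have hK : 0 < K := by omega
  have hKR : (1 : ℝ) ≤ K := by exact_mod_cast hK
  obtain ⟨τ, hτdef⟩ : ∃ τ : ℝ, τ = c / (43 * (4 * (K : ℝ) ^ 2) ^ 2) := ⟨_, rfl⟩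
  have hτ : 0 < τ := by rw [hτdef]; positivity
  have hτ₁ : τ ≤ 1 := by
    rw [hτdef, div_le_one (by positivity)]
    nlinarith [one_le_pow₀ hKR (n := 2), one_le_pow₀ hKR (n := 4)]
  have hτK : τ ≤ 4 * (K : ℝ) ^ 2 := by nlinarith [one_le_pow₀ hKR (n := 2)]
  have hτ₂ : 42 * (4 * (K : ℝ) ^ 2) ^ 2 * τ < c := by
    have : 43 * (4 * (K : ℝ) ^ 2) ^ 2 * τ = c := by
      rw [hτdef]; exact mul_div_cancel₀ _ (by positivity)
    have h2 : 0 < (4 * (K : ℝ) ^ 2) ^ 2 * τ := by positivity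
    linarith
  obtain ⟨σ, hσdef⟩ : ∃ σ : ℝ, σ = (τ ^ 3 / 16) ^ 4 / 2 ^ 20 := ⟨_, rfl⟩
  have hσ : 0 < σ := by rw [hσdef]; positivity
  have hσ₁ : σ ≤ 1 := by
    rw [hσdef, div_le_one (by positivity)]
    have : τ ^ 3 / 16 ≤ 1 := by
      have := pow_le_one₀ hτ.le hτ₁ (n := 3)
      linarith
    exact (pow_le_one₀ (by positivity) this).trans (by norm_num)
  obtain ⟨κ, hκdef⟩ : ∃ κ : ℝ, κ = 1 / (8 * (K : ℝ) ^ 2) := ⟨_, rfl⟩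
  have hκ : 0 < κ := by rw [hκdef]; positivity
  obtain ⟨C₀, hC₀⟩ : ∃ C₀ : ℝ, C₀ = 8 * ((2 * K ^ 2) ^ 5 / σ) * (65 * K ^ 2 / σ) := ⟨_, rfl⟩
  have hC₀pos : 0 < C₀ := by rw [hC₀]; positivity
  refine ⟨κ * σ, 16 / (κ ^ 5 * σ), C₀ + N₁ + 2 / c + 1, by positivity, by positivity,
    by positivity, fun N A hAN hfree α hα hα₁ hA hC => ?_⟩
  have hlogN : 0 ≤ Real.log N := Real.log_natCast_nonneg N
  have hC6 : C₀ + N₁ + 2 / c + 1 ≤ Real.log N :=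
    hC.trans (mul_le_of_le_one_right hlogN (pow_le_one₀ hα.le hα₁))
  have hcpos : 0 < 2 / c := by positivity
  have hN₁R : (0 : ℝ) ≤ N₁ := Nat.cast_nonneg _
  have hN : 0 < N := by
    rcases Nat.eq_zero_or_pos N with h | h
    · rw [h, Nat.cast_zero, Real.log_zero] at hC6
      linarith
    · exact h
  have hNR : (1 : ℝ) ≤ N := by exact_mod_cast hN
  have hlog_le : Real.log N ≤ N := (Real.log_le_sub_one_of_pos (by positivity)).trans (by linarith)
  have hNN₁ : N₁ ≤ N := by
    have : (N₁ : ℝ) ≤ N := by linarith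
    exact_mod_cast this
  have hbig : 2 ≤ c * α ^ 2 * N ^ 2 := by
    have h1 : 2 / c ≤ α ^ 2 * N ^ 2 := by
      calc 2 / c ≤ Real.log N * α ^ 6 := by linarith
        _ ≤ N * α ^ 2 := by
          refine mul_le_mul hlog_le (pow_le_pow_of_le_one hα.le hα₁ (by norm_num)) (by positivity)
            (by positivity)
        _ ≤ α ^ 2 * N ^ 2 := by
          rw [mul_comm]
          exact mul_le_mul_of_nonneg_left (by nlinarith) (by positivity)
    rw [div_le_iff₀ hc] at h1
    linarith
  obtain ⟨p, hprime, hKp, hpK⟩ := Nat.exists_prime_lt_and_le_two_mul (K * N) (by positivity)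
  have : Fact p.Prime := ⟨hprime⟩
  rw [← mul_assoc] at hpK
  have hKN : K ≤ K * N := Nat.le_mul_of_pos_right _ hN
  have hNp : N ≤ p := (Nat.le_mul_of_pos_left N hK).trans hKp.le
  have hpsum : (entrySum T₀ + entrySum T₁ + entrySum T₂) * N < p :=
    lt_of_le_of_lt (Nat.mul_le_mul_right _ (by omega)) hKp
  have htri : trilinear (T₀.map (Int.castRingHom (ZMod p))) (T₁.map (Int.castRingHom (ZMod p)))
      (T₂.map (Int.castRingHom (ZMod p))) (push p A) (push p A) (push p A) ≤ #A := by
    rw [trilinear_push]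
    exact_mod_cast hfree.card_solutions_le hsum h₂ hpsum hAN
  have htribox : c * (N : ℝ) ^ 4 ≤ trilinear (T₀.map (Int.castRingHom (ZMod p)))
      (T₁.map (Int.castRingHom (ZMod p))) (T₂.map (Int.castRingHom (ZMod p)))
      (push p (box N)) (push p (box N)) (push p (box N)) := by
    rw [trilinear_push]
    refine (hbox N hNN₁).trans ?_
    norm_cast
    refine card_le_card fun t ht => ?_
    rw [mem_filter] at ht ⊢
    refine ⟨ht.1, ?_⟩
    rw [ht.2]
    funext i
    simp [red]
  have hcube := le_sum_norm_fourier_cube hN hNp hpK (det_map_ne_zero h₀ (by omega))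
    (det_map_ne_zero h₁ (by omega)) (det_map_ne_zero h₂ (by omega)) htri htribox hα hA hbig hτ hτK hτ₂
  obtain ⟨S, hS, E, hE₀, hEα, hSE, hE⟩ := exists_large_spectrum hN hNp hpK hAN hα hα₁ hA hτ hcube
  rw [← hσdef] at hSE
  have hk : 0 < #S := card_pos.2 hS
  have hkR : (1 : ℝ) ≤ #S := by exact_mod_cast hk
  have hσE : σ ≤ E := by
    have h5 : σ ^ 5 ≤ E ^ 5 :=
      (pow_le_of_le_one hσ.le hσ₁ (by norm_num)).trans ((le_mul_of_one_le_left hσ.le hkR).trans hSE)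
    exact le_of_pow_le_pow_left₀ (by norm_num) hE₀ h5
  have hkle : (#S : ℝ) * α ^ 5 ≤ (2 * K ^ 2) ^ 5 / σ := by
    rw [le_div_iff₀ hσ]
    calc (#S : ℝ) * α ^ 5 * σ = #S * σ * α ^ 5 := by ring
      _ ≤ E ^ 5 * α ^ 5 := by gcongr
      _ = (E * α) ^ 5 := by ring
      _ ≤ (2 * K ^ 2) ^ 5 := by gcongr
  have hlog : 8 * (#S : ℝ) * (65 * K ^ 2 / (α * σ)) ≤ Real.log N := by
    have h1 : 8 * ((#S : ℝ) * α ^ 5) * (65 * K ^ 2 / σ) ≤ C₀ := by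
      rw [hC₀]
      gcongr
    have h2 : 8 * (#S : ℝ) * (65 * K ^ 2 / (α * σ)) * α ^ 6 =
        8 * ((#S : ℝ) * α ^ 5) * (65 * K ^ 2 / σ) := by
      field_simp
    refine le_of_mul_le_mul_right ?_ (pow_pos hα 6)
    rw [h2]
    linarith
  obtain ⟨L, hL, hLN, hlogL, hscale⟩ := exists_scale hK hk hα hα₁ hσ hσ₁ hσE hEα hlog
  obtain ⟨q, hq, hqle, hqS⟩ := exists_dilate_small S (M := 12 * L) (by positivity)
  obtain ⟨hqL, hqLE⟩ := hscale q hqle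
  obtain ⟨A', hA'L, hA'free, hA'⟩ := hfree.exists_dense_box hsum hN hK hL hNp hpK hpsum hAN hα hA hE
    hq hqS hqL hqLE
  have hx : 1 + E / (8 * (K : ℝ) ^ 2) = 1 + κ * E := by rw [hκdef]; ring
  refine ⟨1 + κ * E, add_le_add_right (mul_le_mul_of_nonneg_left hσE hκ.le) 1, L, hL, hLN, A', hA'L,
    hA'free, by rwa [← hx], hlogL.trans ?_⟩
  refine mul_le_mul_of_nonneg_right ?_ (Real.log_natCast_nonneg L)
  rw [div_mul_eq_mul_div, le_div_iff₀ (by positivity)]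
  calc 16 * (#S : ℝ) * (κ ^ 5 * σ) = 16 * (κ ^ 5 * (#S * σ)) := by ring
    _ ≤ 16 * (κ ^ 5 * E ^ 5) := by gcongr
    _ = 16 * (κ * E) ^ 5 := by ring
    _ ≤ 16 * (1 + κ * E) ^ 5 := by
        have : κ * E ≤ 1 + κ * E := by linarith
        gcongr

end Increment

lemma exists_log_mul_density_pow_le {T₀ T₁ T₂ : Matrix (Fin 2) (Fin 2) ℤ}
    (hsum : T₀ + T₁ + T₂ = 0) (h₀ : T₀.det ≠ 0) (h₁ : T₁.det ≠ 0) (h₂ : T₂.det ≠ 0) :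
    ∃ B : ℕ, B ≠ 0 ∧ ∃ C : ℝ, 0 < C ∧ ∀ (N : ℕ) (A : Finset (Fin 2 → ℤ)), A ⊆ box N →
      SolutionFree T₀ T₁ T₂ A → Real.log N * (#A / (N : ℝ) ^ 2) ^ B ≤ C := by
  obtain ⟨η, C₁, C, hη, hC₁, hC, hinc⟩ := exists_increment hsum h₀ h₁ h₂
  obtain ⟨b, hb⟩ := pow_unbounded_of_one_lt C₁ (by linarith : 1 < 1 + η)
  obtain ⟨B, hB⟩ : ∃ B, B = b + 6 := ⟨_, rfl⟩
  have hxB : ∀ x, 1 + η ≤ x → C₁ * x ^ 5 ≤ x ^ B := fun x hx => by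
    have hx₁ : 1 ≤ x := by linarith
    rw [hB, pow_add]
    exact mul_le_mul (hb.le.trans (pow_le_pow_left₀ (by positivity) hx b))
      (pow_le_pow_right₀ hx₁ (by norm_num)) (by positivity) (by positivity)
  have hB₀ : B ≠ 0 := by omega
  have hB₆ : 6 ≤ B := by omega
  clear hB
  refine ⟨B, hB₀, C, hC, fun N => ?_⟩
  induction N using Nat.strong_induction_on with
  | _ N ih =>
    intro A hAN hfree
    by_contra! hcon
    set α : ℝ := #A / (N : ℝ) ^ 2 with hα
    have hlogN : 0 ≤ Real.log N := Real.log_natCast_nonneg N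
    have hα₀ : 0 ≤ α := by positivity
    have hαpos : 0 < α := by
      rcases hα₀.eq_or_lt with h | h
      · rw [← h, zero_pow hB₀, mul_zero] at hcon
        linarith
      · exact h
    have hN : (0 : ℝ) < N := by
      rcases Nat.eq_zero_or_pos N with h | h
      · rw [h, Nat.cast_zero, Real.log_zero, zero_mul] at hcon
        linarith
      · exact_mod_cast h
    have hα₁ : α ≤ 1 := by
      rw [hα, div_le_one (by positivity)]
      have := card_le_card hAN
      rw [card_box] at this
      exact_mod_cast this
    have hA : (#A : ℝ) = α * N ^ 2 := by rw [hα, div_mul_cancel₀ _ (by positivity)]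
    have hC6 : C ≤ Real.log N * α ^ 6 :=
      hcon.le.trans (mul_le_mul_of_nonneg_left (pow_le_pow_of_le_one hα₀ hα₁ hB₆) hlogN)
    obtain ⟨x, hx, L, hL, hLN, A', hA'L, hA'free, hA', hlog⟩ :=
      hinc N A hAN hfree α hαpos hα₁ hA hC6
    have hLR : (0 : ℝ) < L := Nat.cast_pos.2 hL
    have hlogL : 0 ≤ Real.log L := Real.log_natCast_nonneg L
    have hx₀ : 0 ≤ x := by linarith
    have hxpow := hxB x hx
    have hdens : α * x ≤ #A' / (L : ℝ) ^ 2 := by rwa [le_div_iff₀ (by positivity)]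
    have hle : Real.log N * α ^ B ≤ Real.log L * (#A' / (L : ℝ) ^ 2) ^ B := by
      calc Real.log N * α ^ B ≤ C₁ * x ^ 5 * Real.log L * α ^ B :=
            mul_le_mul_of_nonneg_right hlog (pow_nonneg hα₀ _)
        _ ≤ x ^ B * Real.log L * α ^ B :=
            mul_le_mul_of_nonneg_right (mul_le_mul_of_nonneg_right hxpow hlogL) (pow_nonneg hα₀ _)
        _ = Real.log L * (α * x) ^ B := by rw [mul_pow]; ring
        _ ≤ Real.log L * (#A' / (L : ℝ) ^ 2) ^ B :=
            mul_le_mul_of_nonneg_left (pow_le_pow_left₀ (mul_nonneg hα₀ hx₀) hdens B) hlogL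
    linarith [ih L hLN A' hA'L hA'free]

lemma exists_common_denominator {ι : Type*} [Fintype ι] (f : ι → ℚ) :
    ∃ D : ℕ, 0 < D ∧ ∃ g : ι → ℤ, ∀ i, (g i : ℚ) = D * f i := by
  classical
  refine ⟨∏ i, (f i).den, prod_pos fun i _ => (f i).den_pos,
    fun i => (∏ j ∈ univ.erase i, (f j).den : ℕ) * (f i).num, fun i => ?_⟩
  have h : (f i).num = ((f i).den : ℚ) * f i := (Rat.den_mul_eq_num (f i)).symm
  rw [← mul_prod_erase univ (fun j => (f j).den) (mem_univ i)]
  push_cast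
  rw [h]
  ring

lemma exists_card_le_of_no_translate {v : ℤ × ℤ} (hv : v ≠ 0) :
    ∃ C : ℕ, 0 < C ∧ ∀ n : ℕ, 0 < n → ∀ A : Finset (ℤ × ℤ),
      A ⊆ Ico (0 : ℤ) n ×ˢ Ico (0 : ℤ) n →
      (∀ x ∈ A, ∀ y ∈ A, ∀ s : ℤ, y = x + s • v → s = 0) → #A ≤ C * n := by
  obtain ⟨v₁, v₂⟩ := v
  set m : ℕ := v₁.natAbs ^ 2 + v₂.natAbs ^ 2 with hm
  have hmZ : (m : ℤ) = v₁ ^ 2 + v₂ ^ 2 := by simp [hm]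
  have hmpos : 0 < m := by
    by_contra h
    have h0 : m = 0 := by omega
    rw [hm] at h0
    have h1 : v₁ = 0 := by simpa using (Nat.add_eq_zero_iff.1 h0).1
    have h2 : v₂ = 0 := by simpa using (Nat.add_eq_zero_iff.1 h0).2
    exact hv (by rw [h1, h2]; rfl)
  set H : ℕ := v₁.natAbs + v₂.natAbs with hH
  refine ⟨m * (2 * H + 1), by positivity, fun n hn A hA hfree => ?_⟩
  have hmaps : ∀ x ∈ A, ((v₁ * x.1 + v₂ * x.2) % (m : ℤ), v₁ * x.2 - v₂ * x.1) ∈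
      Ico (0 : ℤ) m ×ˢ Icc (-(H * n : ℤ)) (H * n) := fun x hx => by
    have hx' := hA hx
    simp only [mem_product, mem_Ico] at hx'
    obtain ⟨⟨ha, hb⟩, hc, hd⟩ := hx'
    have hmZpos : (0 : ℤ) < m := by exact_mod_cast hmpos
    simp only [mem_product, mem_Ico, mem_Icc, ← abs_le]
    refine ⟨⟨Int.emod_nonneg _ hmZpos.ne', Int.emod_lt_of_pos _ hmZpos⟩, ?_⟩
    calc |v₁ * x.2 - v₂ * x.1| ≤ |v₁ * x.2| + |v₂ * x.1| := abs_sub _ _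
      _ = |v₁| * x.2 + |v₂| * x.1 := by rw [abs_mul, abs_mul, abs_of_nonneg ha, abs_of_nonneg hc]
      _ ≤ |v₁| * n + |v₂| * n := by gcongr
      _ = H * n := by rw [hH]; push_cast; ring
  have hinj : Set.InjOn (fun x : ℤ × ℤ => ((v₁ * x.1 + v₂ * x.2) % (m : ℤ), v₁ * x.2 - v₂ * x.1))
      (A : Set (ℤ × ℤ)) := by
    intro x hx y hy hxy
    simp only [Prod.mk.injEq] at hxy
    obtain ⟨hmod, hcross⟩ := hxy
    obtain ⟨s, hs⟩ := Int.ModEq.dvd hmod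
    have hm0 : (m : ℤ) ≠ 0 := by exact_mod_cast hmpos.ne'
    have e₁ : y.1 = x.1 + s * v₁ := by
      refine mul_left_cancel₀ hm0 ?_
      rw [hmZ] at hs ⊢
      linear_combination v₁ * hs + v₂ * hcross
    have e₂ : y.2 = x.2 + s * v₂ := by
      refine mul_left_cancel₀ hm0 ?_
      rw [hmZ] at hs ⊢
      linear_combination v₂ * hs - v₁ * hcross
    have h0 := hfree x hx y hy s (Prod.ext (by simpa using e₁) (by simpa using e₂))
    rw [h0, zero_mul, add_zero] at e₁ e₂
    exact (Prod.ext e₁ e₂).symm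
  have hcard := card_le_card_of_injOn _ hmaps hinj
  rw [card_product, Int.card_Ico, Int.card_Icc] at hcard
  refine hcard.trans ?_
  have h1 : ((m : ℤ) - 0).toNat = m := by omega
  have h2 : ((H : ℤ) * n + 1 - -(H * n : ℤ)).toNat = 2 * (H * n) + 1 := by
    have : (H : ℤ) * n + 1 - -(H * n : ℤ) = (2 * (H * n) + 1 : ℕ) := by push_cast; ring
    rw [this, Int.toNat_natCast]
  rw [h1, h2, mul_assoc]
  refine Nat.mul_le_mul_left _ ?_
  nlinarith

/-- The set `A` contains no configuration `x, x + M₁ y, x + M₂ y` with `y ≠ 0`. -/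
def ConfigurationFree (M₁ M₂ : Matrix (Fin 2) (Fin 2) ℚ) (A : Finset (ℤ × ℤ)) : Prop :=
  ¬ ∃ x y : ℤ × ℤ, y ≠ 0 ∧ x ∈ A ∧
    (∃ z ∈ A,
      (z.1 : ℚ) = (x.1 : ℚ) + M₁.mulVec ![(y.1 : ℚ), (y.2 : ℚ)] 0 ∧
      (z.2 : ℚ) = (x.2 : ℚ) + M₁.mulVec ![(y.1 : ℚ), (y.2 : ℚ)] 1) ∧
    (∃ z ∈ A,
      (z.1 : ℚ) = (x.1 : ℚ) + M₂.mulVec ![(y.1 : ℚ), (y.2 : ℚ)] 0 ∧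
      (z.2 : ℚ) = (x.2 : ℚ) + M₂.mulVec ![(y.1 : ℚ), (y.2 : ℚ)] 1)

section Reduction

variable {M₁ M₂ : Matrix (Fin 2) (Fin 2) ℚ}

lemma exists_common_integer_value (h₁ : M₁.det ≠ 0) (h : (M₁ - M₂).det = 0) :
    ∃ y v : ℤ × ℤ, y ≠ 0 ∧ v ≠ 0 ∧ M₁ *ᵥ ![(y.1 : ℚ), (y.2 : ℚ)] = ![(v.1 : ℚ), (v.2 : ℚ)] ∧
      M₂ *ᵥ ![(y.1 : ℚ), (y.2 : ℚ)] = ![(v.1 : ℚ), (v.2 : ℚ)] := by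
  obtain ⟨w, hw, hMw⟩ := exists_mulVec_eq_zero_iff.2 h
  obtain ⟨D, hD, g, hg⟩ := exists_common_denominator (Sum.elim w (M₁ *ᵥ w))
  have hDQ : (D : ℚ) ≠ 0 := by exact_mod_cast hD.ne'
  have hy : ![((g (.inl 0) : ℤ) : ℚ), (g (.inl 1) : ℤ)] = (D : ℚ) • w := by
    funext i; fin_cases i <;> simp [hg]
  have hv : ![((g (.inr 0) : ℤ) : ℚ), (g (.inr 1) : ℤ)] = (D : ℚ) • (M₁ *ᵥ w) := by
    funext i; fin_cases i <;> simp [hg]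
  have h12 : M₁ *ᵥ w = M₂ *ᵥ w := by rwa [sub_mulVec, sub_eq_zero] at hMw
  refine ⟨(g (.inl 0), g (.inl 1)), (g (.inr 0), g (.inr 1)), ?_, ?_, ?_, ?_⟩
  · intro h0
    simp only [Prod.mk_eq_zero] at h0
    rw [h0.1, h0.2] at hy
    exact hw ((smul_eq_zero.1 (hy.symm.trans (by simp))).resolve_left hDQ)
  · intro h0
    simp only [Prod.mk_eq_zero] at h0
    rw [h0.1, h0.2] at hv
    exact hw (eq_zero_of_mulVec_eq_zero h₁
      ((smul_eq_zero.1 (hv.symm.trans (by simp))).resolve_left hDQ))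
  · rw [hy, hv, mulVec_smul]
  · rw [hy, hv, mulVec_smul, h12]

lemma exists_linear_bound (h₁ : M₁.det ≠ 0) (h : (M₁ - M₂).det = 0) :
    ∃ C : ℕ, 0 < C ∧ ∀ n : ℕ, 0 < n → ∀ A : Finset (ℤ × ℤ),
      A ⊆ Ico (0 : ℤ) n ×ˢ Ico (0 : ℤ) n → ConfigurationFree M₁ M₂ A → #A ≤ C * n := by
  obtain ⟨y, v, hy, hv, e₁, e₂⟩ := exists_common_integer_value h₁ h
  obtain ⟨C, hC, hbound⟩ := exists_card_le_of_no_translate hv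
  refine ⟨C, hC, fun n hn A hA hfree => hbound n hn A hA fun x hx z hz s hs => ?_⟩
  by_contra hs0
  have hsy : ![((s • y).1 : ℚ), ((s • y).2 : ℚ)] = (s : ℚ) • ![(y.1 : ℚ), (y.2 : ℚ)] := by
    funext i; fin_cases i <;> simp
  refine hfree ⟨x, s • y, smul_ne_zero hs0 hy, hx, ⟨z, hz, ?_⟩, z, hz, ?_⟩
  · rw [hsy, mulVec_smul, e₁, hs]; simp
  · rw [hsy, mulVec_smul, e₂, hs]; simp

lemma exists_logarithmic_bound (h₁ : M₁.det ≠ 0) (h₂ : M₂.det ≠ 0) (h : (M₁ - M₂).det ≠ 0) :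
    ∃ c : ℝ, 0 < c ∧ ∃ C : ℝ, 0 < C ∧ ∀ n : ℕ, 2 ≤ n → ∀ A : Finset (ℤ × ℤ),
      A ⊆ Ico (0 : ℤ) n ×ˢ Ico (0 : ℤ) n → ConfigurationFree M₁ M₂ A →
      (#A : ℝ) ≤ C * (n : ℝ) ^ 2 / Real.log n ^ c := by
  classical
  obtain ⟨D, hD, g, hg⟩ := exists_common_denominator
    (Sum.elim (fun t : Fin 2 × Fin 2 => M₁⁻¹ t.1 t.2) (fun t : Fin 2 × Fin 2 => M₂⁻¹ t.1 t.2))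
  have hDQ : (D : ℚ) ≠ 0 := by exact_mod_cast hD.ne'
  set T₁ : Matrix (Fin 2) (Fin 2) ℤ := of fun i j => g (.inl (i, j)) with hT₁
  set T₂ : Matrix (Fin 2) (Fin 2) ℤ := of fun i j => g (.inr (i, j)) with hT₂
  have e₁ : T₁.map (Int.castRingHom ℚ) = (D : ℚ) • M₁⁻¹ := by
    ext i j; exact hg (.inl (i, j))
  have e₂ : T₂.map (Int.castRingHom ℚ) = (D : ℚ) • M₂⁻¹ := by
    ext i j; exact hg (.inr (i, j))
  have hdet : ∀ T : Matrix (Fin 2) (Fin 2) ℤ, (T.map (Int.castRingHom ℚ)).det ≠ 0 → T.det ≠ 0 := by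
    intro T hT h0
    refine hT ?_
    rw [← RingHom.mapMatrix_apply, ← RingHom.map_det, h0, map_zero]
  have u₁ : IsUnit M₁.det := h₁.isUnit
  have u₂ : IsUnit M₂.det := h₂.isUnit
  have d₁ : T₁.det ≠ 0 := hdet _ (by
    rw [e₁, det_smul]; exact mul_ne_zero (by simpa using hDQ) (isUnit_nonsing_inv_det _ u₁).ne_zero)
  have d₂ : T₂.det ≠ 0 := hdet _ (by
    rw [e₂, det_smul]; exact mul_ne_zero (by simpa using hDQ) (isUnit_nonsing_inv_det _ u₂).ne_zero)
  have d₀ : (T₂ - T₁).det ≠ 0 := hdet _ (by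
    have hinv : M₂⁻¹ - M₁⁻¹ = M₁⁻¹ * (M₁ - M₂) * M₂⁻¹ := by
      rw [mul_sub, sub_mul, nonsing_inv_mul _ u₁, one_mul, mul_assoc, mul_nonsing_inv _ u₂, mul_one]
    have hmap : (T₂ - T₁).map (Int.castRingHom ℚ) = (D : ℚ) • (M₂⁻¹ - M₁⁻¹) := by
      rw [smul_sub, ← e₁, ← e₂]
      exact Matrix.map_sub _ (fun a b => map_sub _ a b) _ _
    rw [hmap, hinv, det_smul, det_mul, det_mul]
    exact mul_ne_zero (by simpa using hDQ) (mul_ne_zero (mul_ne_zero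
      (isUnit_nonsing_inv_det _ u₁).ne_zero h) (isUnit_nonsing_inv_det _ u₂).ne_zero))
  have inv₁ : ∀ u : Fin 2 → ℤ, M₁ *ᵥ (fun i => ((T₁ *ᵥ u) i : ℚ)) = fun i => (D : ℚ) * u i := by
    intro u
    have : (fun i => ((T₁ *ᵥ u) i : ℚ)) = T₁.map (Int.castRingHom ℚ) *ᵥ fun i => (u i : ℚ) := by
      funext i
      exact RingHom.map_mulVec (Int.castRingHom ℚ) T₁ u i
    rw [this, e₁, mulVec_mulVec, mul_smul_comm, mul_nonsing_inv _ u₁, smul_mulVec, one_mulVec]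
    rfl
  have inv₂ : ∀ u : Fin 2 → ℤ, M₂ *ᵥ (fun i => ((T₂ *ᵥ u) i : ℚ)) = fun i => (D : ℚ) * u i := by
    intro u
    have : (fun i => ((T₂ *ᵥ u) i : ℚ)) = T₂.map (Int.castRingHom ℚ) *ᵥ fun i => (u i : ℚ) := by
      funext i
      exact RingHom.map_mulVec (Int.castRingHom ℚ) T₂ u i
    rw [this, e₂, mulVec_mulVec, mul_smul_comm, mul_nonsing_inv _ u₂, smul_mulVec, one_mulVec]
    rfl
  obtain ⟨B, hB, C, hC, hbound⟩ := exists_log_mul_density_pow_le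
    (T₀ := T₂ - T₁) (T₁ := T₁) (T₂ := -T₂) (by abel) d₀ d₁ (by rw [det_neg]; simpa using d₂)
  refine ⟨(B : ℝ)⁻¹, by positivity, (D : ℝ) ^ 2 * C ^ (B : ℝ)⁻¹, by positivity,
    fun n hn A hA hfree => ?_⟩
  have hnR : (0 : ℝ) < n := by positivity
  have hlog : 0 < Real.log n := Real.log_pos (by exact_mod_cast hn)
  set F : ℤ × ℤ → Finset (Fin 2 → ℤ) := fun r =>
    {u ∈ box n | (r.1 + D * u 0, r.2 + D * u 1) ∈ A} with hF
  have hFfree : ∀ r, SolutionFree (T₂ - T₁) T₁ (-T₂) (F r) := by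
    intro r a ha b hb c hc habc
    rw [hF, mem_filter] at ha hb hc
    by_contra hne
    have hT : T₁ *ᵥ (b - a) = T₂ *ᵥ (c - a) := by
      rw [mulVec_sub, mulVec_sub]
      rw [sub_mulVec, neg_mulVec] at habc
      rw [← sub_eq_zero, ← habc]
      abel
    set y := T₁ *ᵥ (b - a) with hy
    have hvec : ![(y 0 : ℚ), (y 1 : ℚ)] = fun i => (y i : ℚ) := by
      funext i; fin_cases i <;> rfl
    refine hfree ⟨(r.1 + D * a 0, r.2 + D * a 1), (y 0, y 1), ?_, ha.2, ⟨_, hb.2, ?_⟩, _, hc.2, ?_⟩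
    · intro h0
      simp only [Prod.mk_eq_zero] at h0
      have hy0 : T₁ *ᵥ (b - a) = 0 := by
        funext i; fin_cases i
        · exact h0.1
        · exact h0.2
      exact hne (sub_eq_zero.1 (eq_zero_of_mulVec_eq_zero d₁ hy0)).symm
    · rw [hvec, hy, inv₁]
      simp only [Pi.sub_apply]
      constructor <;> push_cast <;> ring
    · rw [hvec, hT, inv₂]
      simp only [Pi.sub_apply]
      constructor <;> push_cast <;> ring
  have hFcard : ∀ r, (#(F r) : ℝ) ≤ n ^ 2 * (C / Real.log n) ^ (B : ℝ)⁻¹ := by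
    intro r
    have h1 := hbound n (F r) (filter_subset _ _) (hFfree r)
    rw [mul_comm, ← le_div_iff₀ hlog] at h1
    have h2 := Real.rpow_le_rpow (by positivity) h1 (by positivity : (0 : ℝ) ≤ (B : ℝ)⁻¹)
    rw [Real.pow_rpow_inv_natCast (by positivity) hB, div_le_iff₀ (by positivity)] at h2
    linarith
  have hDZ : (0 : ℤ) < D := by exact_mod_cast hD
  have hsumA : #A ≤ ∑ r ∈ Ico (0 : ℤ) D ×ˢ Ico (0 : ℤ) D, #(F r) := by
    rw [card_eq_sum_card_fiberwise (f := fun x : ℤ × ℤ => (x.1 % (D : ℤ), x.2 % (D : ℤ)))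
      (t := Ico (0 : ℤ) D ×ˢ Ico (0 : ℤ) D)]
    · refine sum_le_sum fun r _ => card_le_card_of_injOn (fun x => ![x.1 / D, x.2 / D]) ?_ ?_
      · intro x hx
        rw [mem_coe, mem_filter] at hx
        obtain ⟨hx, rfl⟩ := hx
        have hx' := hA hx
        simp only [mem_product, mem_Ico] at hx'
        rw [hF, mem_coe, mem_filter, mem_box]
        refine ⟨fun i => ?_, ?_⟩
        · fin_cases i
          · exact ⟨Int.ediv_nonneg hx'.1.1 hDZ.le, (Int.ediv_le_self _ hx'.1.1).trans_lt hx'.1.2⟩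
          · exact ⟨Int.ediv_nonneg hx'.2.1 hDZ.le, (Int.ediv_le_self _ hx'.2.1).trans_lt hx'.2.2⟩
        · simpa [Int.emod_add_mul_ediv] using hx
      · intro x hx z hz hxz
        rw [mem_coe, mem_filter] at hx hz
        have hmod := hx.2.trans hz.2.symm
        simp only [Prod.mk.injEq] at hmod
        have q₀ : x.1 / (D : ℤ) = z.1 / D := congrFun hxz 0
        have q₁ : x.2 / (D : ℤ) = z.2 / D := congrFun hxz 1
        refine Prod.ext ?_ ?_
        · rw [← Int.emod_add_mul_ediv x.1 D, hmod.1, q₀, Int.emod_add_mul_ediv]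
        · rw [← Int.emod_add_mul_ediv x.2 D, hmod.2, q₁, Int.emod_add_mul_ediv]
    · intro x _
      simp only [coe_product, Set.mem_prod, mem_coe, mem_Ico]
      exact ⟨⟨Int.emod_nonneg _ hDZ.ne', Int.emod_lt_of_pos _ hDZ⟩,
        Int.emod_nonneg _ hDZ.ne', Int.emod_lt_of_pos _ hDZ⟩
  calc (#A : ℝ) ≤ ∑ r ∈ Ico (0 : ℤ) D ×ˢ Ico (0 : ℤ) D, (#(F r) : ℝ) := by exact_mod_cast hsumA
    _ ≤ ∑ r ∈ Ico (0 : ℤ) D ×ˢ Ico (0 : ℤ) D, n ^ 2 * (C / Real.log n) ^ (B : ℝ)⁻¹ :=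
        sum_le_sum fun r _ => hFcard r
    _ = (D : ℝ) ^ 2 * C ^ (B : ℝ)⁻¹ * (n : ℝ) ^ 2 / Real.log n ^ (B : ℝ)⁻¹ := by
        rw [sum_const, card_product, Int.card_Ico, sub_zero, Int.toNat_natCast, nsmul_eq_mul,
          Real.div_rpow hC.le hlog.le]
        push_cast
        ring

end Reduction

end TwoMatrix

/-- Density bound in the case of two matrices: for distinct invertible `2 × 2`
rational matrices `M₁ ≠ M₂` there exist `c > 0`, `C > 0` and `N₀` such that for
all `n ≥ N₀`, every `A ⊆ [n] × [n] ⊂ ℤ²` containing no configuration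
`x, x + M₁y, x + M₂y` (with `y ∈ ℤ²`, `y ≠ 0`, all points being lattice points)
satisfies `|A| ≤ C·n²/(log n)^c`. -/
theorem two_matrix_configuration_density
    (M₁ M₂ : Matrix (Fin 2) (Fin 2) ℚ)
    (hdet₁ : M₁.det ≠ 0) (hdet₂ : M₂.det ≠ 0) (hne : M₁ ≠ M₂) :
    ∃ c : ℝ, 0 < c ∧ ∃ C : ℝ, 0 < C ∧ ∃ N₀ : ℕ, ∀ n : ℕ, N₀ ≤ n →
      ∀ A : Finset (ℤ × ℤ),
        A ⊆ Finset.Ico (0 : ℤ) (n : ℤ) ×ˢ Finset.Ico (0 : ℤ) (n : ℤ) →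
        (¬ ∃ x y : ℤ × ℤ, y ≠ 0 ∧ x ∈ A ∧
          (∃ z ∈ A,
            (z.1 : ℚ) = (x.1 : ℚ) + M₁.mulVec ![(y.1 : ℚ), (y.2 : ℚ)] 0 ∧
            (z.2 : ℚ) = (x.2 : ℚ) + M₁.mulVec ![(y.1 : ℚ), (y.2 : ℚ)] 1) ∧
          (∃ z ∈ A,
            (z.1 : ℚ) = (x.1 : ℚ) + M₂.mulVec ![(y.1 : ℚ), (y.2 : ℚ)] 0 ∧
            (z.2 : ℚ) = (x.2 : ℚ) + M₂.mulVec ![(y.1 : ℚ), (y.2 : ℚ)] 1)) →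
        (A.card : ℝ) ≤ C * (n : ℝ) ^ 2 / (Real.log n) ^ c := by
  by_cases h : (M₁ - M₂).det = 0
  · obtain ⟨C, hC, hbound⟩ := TwoMatrix.exists_linear_bound hdet₁ h
    refine ⟨1, one_pos, C, by exact_mod_cast hC, 2, fun n hn A hA hfree => ?_⟩
    have hlog : 0 < Real.log n := Real.log_pos (by exact_mod_cast hn)
    have hn₀ : (0 : ℝ) < n := by positivity
    have hlog_le : Real.log n ≤ n := (Real.log_le_sub_one_of_pos hn₀).trans (by linarith)
    have hcard : (A.card : ℝ) ≤ C * n := by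
      exact_mod_cast hbound n (by omega) A hA hfree
    rw [Real.rpow_one, le_div_iff₀ hlog]
    calc (A.card : ℝ) * Real.log n ≤ C * n * n := by gcongr
      _ = C * (n : ℝ) ^ 2 := by ring
  · obtain ⟨c, hc, C, hC, hbound⟩ := TwoMatrix.exists_logarithmic_bound hdet₁ hdet₂ h
    exact ⟨c, hc, C, hC, 2, hbound⟩
end

section
/- There exists p₀ such that for every prime p ≥ p₀, every 2-colouring of 𝔽_p × 𝔽_p, and all a, b ∈ 𝔽_p with a ≠ 0, b ≠ 0 such that a/b is a quadratic residue in 𝔽_p, there exists a monochromatic collinear triple of distinct points x, y, z ∈ 𝔽_p × 𝔽_p (i.e., z − y is a scalar multiple of y − x) with ‖y − x‖ = a and ‖z − y‖ = b. -/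
section CircleSums

open Finset ComplexConjugate

variable {p : ℕ} [Fact p.Prime]

/-- The circle `v₁² + v₂² = r` in `𝔽_p × 𝔽_p`. -/
def circle (p : ℕ) [Fact p.Prime] (r : ZMod p) : Finset (ZMod p × ZMod p) :=
  univ.filter fun v => v.1 ^ 2 + v.2 ^ 2 = r

/-- Complex multiplication on pairs; for `g` on the unit circle, a rotation. -/
def rot (g v : ZMod p × ZMod p) : ZMod p × ZMod p :=
  (g.1 * v.1 - g.2 * v.2, g.2 * v.1 + g.1 * v.2)

/-- The additive character `v ↦ e(ξ · v)` of the plane. -/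
noncomputable def planeChar (ξ v : ZMod p × ZMod p) : ℂ :=
  ZMod.stdAddChar (ξ.1 * v.1 + ξ.2 * v.2)

/-- The Fourier transform of the indicator function of a circle. -/
noncomputable def circleSum (r : ZMod p) (ξ : ZMod p × ZMod p) : ℂ :=
  ∑ v ∈ circle p r, planeChar ξ v

lemma mem_circle {r : ZMod p} {v : ZMod p × ZMod p} :
    v ∈ circle p r ↔ v.1 ^ 2 + v.2 ^ 2 = r := by
  simp [circle]

lemma planeChar_add (ξ v w : ZMod p × ZMod p) :
    planeChar ξ (v + w) = planeChar ξ v * planeChar ξ w := by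
  simp only [planeChar, ← AddChar.map_add_eq_mul]
  congr 1
  simp only [Prod.fst_add, Prod.snd_add]
  ring

lemma planeChar_neg (ξ v : ZMod p × ZMod p) :
    planeChar ξ (-v) = conj (planeChar ξ v) := by
  rw [planeChar, planeChar, ← AddChar.map_neg_eq_conj]
  congr 1
  simp only [Prod.fst_neg, Prod.snd_neg]
  ring

lemma planeChar_smul (c : ZMod p) (ξ v : ZMod p × ZMod p) :
    planeChar ξ (c • v) = planeChar (c • ξ) v := by
  rw [planeChar, planeChar]
  congr 1
  simp only [Prod.smul_fst, Prod.smul_snd, smul_eq_mul]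
  ring

lemma sum_planeChar (w : ZMod p × ZMod p) :
    ∑ ξ, planeChar ξ w = if w = 0 then (p : ℂ) ^ 2 else 0 := by
  have key (a : ZMod p) : ∑ x : ZMod p, ZMod.stdAddChar (x * a) = if a = 0 then (p : ℂ) else 0 := by
    rw [AddChar.sum_mulShift a (ZMod.isPrimitive_stdAddChar p), ZMod.card]
    split_ifs <;> simp
  simp only [planeChar, AddChar.map_add_eq_mul]
  rw [Fintype.sum_prod_type]
  simp only [← Finset.mul_sum, ← Finset.sum_mul, key]
  rcases w with ⟨w₁, w₂⟩
  by_cases h₁ : w₁ = 0 <;> by_cases h₂ : w₂ = 0 <;> simp [h₁, h₂, sq]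

lemma rot_injective {ξ : ZMod p × ZMod p} (hp : p ≠ 2) (hξ : ξ ≠ 0) :
    Set.InjOn (fun g => rot g ξ) (circle p 1 : Set (ZMod p × ZMod p)) := by
  have h2 : (2 : ZMod p) ≠ 0 := Ring.two_ne_zero (by rwa [ZMod.ringChar_zmod_n])
  rintro ⟨g₁, g₂⟩ hg ⟨h₁, h₂⟩ hh heq
  rw [mem_coe, mem_circle] at hg hh
  simp only [rot, Prod.mk.injEq] at heq hg hh
  obtain ⟨e₁, e₂⟩ := heq
  rcases ξ with ⟨x, y⟩
  simp only at e₁ e₂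
  have hk : (g₁ - h₁) ^ 2 + (g₂ - h₂) ^ 2 = 0 := by
    by_contra hk
    apply hξ
    have hx : ((g₁ - h₁) ^ 2 + (g₂ - h₂) ^ 2) * x = 0 := by
      linear_combination (g₁ - h₁) * e₁ + (g₂ - h₂) * e₂
    have hy : ((g₁ - h₁) ^ 2 + (g₂ - h₂) ^ 2) * y = 0 := by
      linear_combination (g₁ - h₁) * e₂ - (g₂ - h₂) * e₁
    simp [(mul_eq_zero.1 hx).resolve_left hk, (mul_eq_zero.1 hy).resolve_left hk]
  have hdot : g₁ * h₁ + g₂ * h₂ = 1 := by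
    apply mul_left_cancel₀ h2
    linear_combination hg + hh - hk
  have hdet : g₁ * h₂ - g₂ * h₁ = 0 := by
    apply pow_eq_zero_iff two_ne_zero |>.1
    linear_combination (h₁ ^ 2 + h₂ ^ 2) * hg + hh - (g₁ * h₁ + g₂ * h₂ + 1) * hdot
  ext
  · linear_combination h₁ * hdot - g₁ * hh + h₂ * hdet
  · linear_combination h₂ * hdot - g₂ * hh - h₁ * hdet

lemma rot_mem_circle {r : ZMod p} {g v : ZMod p × ZMod p} (hg : g ∈ circle p 1)
    (hv : v ∈ circle p r) : rot g v ∈ circle p r := by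
  rw [mem_circle] at *
  simp only [rot]
  linear_combination (v.1 ^ 2 + v.2 ^ 2) * hg + hv

lemma circleSum_rot {r : ZMod p} {g : ZMod p × ZMod p} (hg : g ∈ circle p 1)
    (ξ : ZMod p × ZMod p) : circleSum r (rot g ξ) = circleSum r ξ := by
  have hg' : (g.1, -g.2) ∈ circle p 1 := by
    rw [mem_circle] at *
    linear_combination hg
  have hg1 := mem_circle.1 hg
  refine Finset.sum_nbij' (rot (g.1, -g.2)) (rot g) (fun v hv => rot_mem_circle hg' hv)
    (fun v hv => rot_mem_circle hg hv) ?_ ?_ ?_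
  · intro v _
    ext <;> simp only [rot]
    · linear_combination v.1 * hg1
    · linear_combination v.2 * hg1
  · intro v _
    ext <;> simp only [rot]
    · linear_combination v.1 * hg1
    · linear_combination v.2 * hg1
  · intro v _
    simp only [planeChar, rot]
    congr 1
    ring

lemma le_card_unit_circle (hp : p ≠ 2) : p ≤ #(circle p 1) + 2 := by
  have h2 : (2 : ZMod p) ≠ 0 := Ring.two_ne_zero (by rwa [ZMod.ringChar_zmod_n])
  have hroots : #(univ.filter fun t : ZMod p => t ^ 2 + 1 = 0) ≤ 2 := by
    by_cases h : ∃ i : ZMod p, i ^ 2 + 1 = 0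
    · obtain ⟨i, hi⟩ := h
      refine (card_le_card (t := {i, -i}) ?_).trans card_le_two
      intro t ht
      simp only [mem_filter, mem_univ, true_and] at ht
      rw [mem_insert, mem_singleton]
      exact sq_eq_sq_iff_eq_or_eq_neg.1 (by linear_combination ht - hi)
    · push Not at h
      simp [h]
  have hinj : #(univ.filter fun t : ZMod p => ¬ t ^ 2 + 1 = 0) ≤ #(circle p 1) := by
    apply card_le_card_of_injOn (fun t => ((1 - t ^ 2) / (t ^ 2 + 1), 2 * t / (t ^ 2 + 1)))
    · intro t ht
      simp only [coe_filter, mem_univ, true_and, Set.mem_ofPred_eq] at ht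
      rw [mem_coe, mem_circle]
      field_simp
      ring
    · intro s hs t ht hst
      simp only [coe_filter, mem_univ, true_and, Set.mem_ofPred_eq] at hs ht
      simp only [Prod.mk.injEq] at hst
      obtain ⟨e₁, e₂⟩ := hst
      rw [div_eq_div_iff hs ht] at e₁ e₂
      have hsq : s ^ 2 = t ^ 2 := by
        apply mul_left_cancel₀ h2
        linear_combination -e₁
      apply mul_left_cancel₀ h2
      apply mul_right_cancel₀ ht
      linear_combination e₂ + 2 * t * hsq
  have := card_filter_add_card_filter_not (s := (univ : Finset (ZMod p))) (fun t => t ^ 2 + 1 = 0)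
  rw [card_univ, ZMod.card] at this
  omega

lemma card_unit_circle_le {r : ZMod p} (hp : p ≠ 2) (hr : r ≠ 0) :
    #(circle p 1) ≤ #(circle p r) := by
  obtain ⟨x, y, hxy⟩ := ZMod.sq_add_sq p r
  refine card_le_card_of_injOn (fun g => rot g (x, y))
    (fun g hg => rot_mem_circle hg (mem_circle.2 hxy)) (rot_injective hp ?_)
  rintro h
  simp only [Prod.mk_eq_zero] at h
  simp [h.1, h.2] at hxy
  exact hr hxy.symm

/-- A nonzero vector is a sum of two points of a given nondegenerate circle in at most two ways. -/
lemma card_circle_reps_le {r : ZMod p} (hp : p ≠ 2) (hr : r ≠ 0) {w : ZMod p × ZMod p}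
    (hw : w ≠ 0) : #((circle p r).filter fun v => w - v ∈ circle p r) ≤ 2 := by
  have h2 : (2 : ZMod p) ≠ 0 := Ring.two_ne_zero (by rwa [ZMod.ringChar_zmod_n])
  rcases eq_empty_or_nonempty ((circle p r).filter fun v => w - v ∈ circle p r) with h | ⟨v, hv⟩
  · simp [h]
  refine (card_le_card (t := {v, w - v}) ?_).trans card_le_two
  intro u hu
  rw [mem_filter, mem_circle, mem_circle] at hu hv
  rcases u with ⟨u₁, u₂⟩
  rcases v with ⟨v₁, v₂⟩
  rcases w with ⟨w₁, w₂⟩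
  simp only [Prod.fst_sub, Prod.snd_sub] at hu hv
  obtain ⟨hu, hu'⟩ := hu
  obtain ⟨hv, hv'⟩ := hv
  have hv2 : 2 * (v₁ * w₁ + v₂ * w₂) = w₁ ^ 2 + w₂ ^ 2 := by linear_combination hv - hv'
  have hdot : u₁ * w₁ + u₂ * w₂ = v₁ * w₁ + v₂ * w₂ := by
    apply mul_left_cancel₀ h2
    linear_combination hu - hu' - hv + hv'
  have hN : w₁ ^ 2 + w₂ ^ 2 ≠ 0 := by
    intro hN
    have hd : v₁ * w₁ + v₂ * w₂ = 0 := by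
      apply mul_left_cancel₀ h2
      linear_combination hv2 + hN
    have hdet : v₁ * w₂ - v₂ * w₁ = 0 := by
      apply pow_eq_zero_iff two_ne_zero |>.1
      linear_combination (v₁ ^ 2 + v₂ ^ 2) * hN - (v₁ * w₁ + v₂ * w₂) * hd
    apply hw
    ext
    · apply mul_left_cancel₀ hr
      simp only [Prod.fst_zero]
      linear_combination v₁ * hd - v₂ * hdet - w₁ * hv
    · apply mul_left_cancel₀ hr
      simp only [Prod.snd_zero]
      linear_combination v₂ * hd + v₁ * hdet - w₂ * hv
  have hdet : (u₁ * w₂ - u₂ * w₁) ^ 2 = (v₁ * w₂ - v₂ * w₁) ^ 2 := by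
    linear_combination (w₁ ^ 2 + w₂ ^ 2) * (hu - hv) -
      (u₁ * w₁ + u₂ * w₂ + v₁ * w₁ + v₂ * w₂) * hdot
  rw [mem_insert, mem_singleton]
  rcases sq_eq_sq_iff_eq_or_eq_neg.1 hdet with h | h
  · left
    ext <;> simp only <;> apply mul_left_cancel₀ hN
    · linear_combination w₁ * hdot + w₂ * h
    · linear_combination w₂ * hdot - w₁ * h
  · right
    ext <;> simp only [Prod.fst_sub, Prod.snd_sub] <;> apply mul_left_cancel₀ hN
    · linear_combination w₁ * hdot + w₂ * h + w₁ * hv2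
    · linear_combination w₂ * hdot - w₁ * h + w₂ * hv2

/-- The additive energy of a nondegenerate circle `C` is at most `3 |C|²`. -/
lemma circle_energy_le {r : ZMod p} (hp : p ≠ 2) (hr : r ≠ 0) :
    ∑ v ∈ circle p r, ∑ w ∈ circle p r,
      #((circle p r).filter fun u => v + w - u ∈ circle p r) ≤ 3 * #(circle p r) ^ 2 := by
  set C := circle p r with hC
  calc ∑ v ∈ C, ∑ w ∈ C, #(C.filter fun u => v + w - u ∈ C)
      ≤ ∑ v ∈ C, ∑ w ∈ C, (2 + if w = -v then #C else 0) := by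
        gcongr with v hv w hw
        split_ifs with h
        · exact (card_filter_le _ _).trans (Nat.le_add_left _ _)
        · exact card_circle_reps_le hp hr fun h0 => h (eq_neg_of_add_eq_zero_right h0)
    _ ≤ ∑ v ∈ C, (2 * #C + #C) := by
        gcongr with v hv
        rw [sum_add_distrib, sum_const, smul_eq_mul, mul_comm, sum_ite_eq']
        gcongr
        split_ifs <;> simp
    _ = 3 * #C ^ 2 := by
        rw [sum_const, smul_eq_mul]
        ring

lemma sum_norm_circleSum_pow_four (r : ZMod p) :
    ∑ ξ, ‖circleSum r ξ‖ ^ 4 = (p : ℝ) ^ 2 * (∑ v ∈ circle p r, ∑ w ∈ circle p r,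
      #((circle p r).filter fun u => v + w - u ∈ circle p r) : ℕ) := by
  set C := circle p r with hC
  have hpt (ξ : ZMod p × ZMod p) : ((‖circleSum r ξ‖ ^ 4 : ℝ) : ℂ) =
      ∑ v ∈ C, ∑ w ∈ C, ∑ u ∈ C, ∑ s ∈ C, planeChar ξ (v + w - u - s) := by
    have h4 : ((‖circleSum r ξ‖ ^ 4 : ℝ) : ℂ) =
        circleSum r ξ * (circleSum r ξ * (conj (circleSum r ξ) * conj (circleSum r ξ))) := by
      have := Complex.mul_conj' (circleSum r ξ)
      push_cast
      linear_combination (-(‖circleSum r ξ‖ : ℂ) ^ 2 - circleSum r ξ * conj (circleSum r ξ)) * this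
    rw [h4]
    simp only [circleSum, map_sum, ← planeChar_neg]
    simp only [sub_eq_add_neg, planeChar_add, mul_assoc, ← mul_sum, ← sum_mul, ← hC]
  have hC4 : ((∑ ξ, ‖circleSum r ξ‖ ^ 4 : ℝ) : ℂ) = (p : ℂ) ^ 2 * (∑ v ∈ C, ∑ w ∈ C,
      #(C.filter fun u => v + w - u ∈ C) : ℕ) := by
    rw [Complex.ofReal_sum]
    simp only [hpt]
    rw [sum_comm]
    push_cast
    rw [mul_sum]
    refine sum_congr rfl fun v _ => ?_
    rw [sum_comm, mul_sum]
    refine sum_congr rfl fun w _ => ?_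
    rw [sum_comm, card_filter]
    push_cast
    rw [mul_sum]
    refine sum_congr rfl fun u _ => ?_
    rw [sum_comm]
    simp only [sum_planeChar, sub_eq_zero, sum_ite_eq, mul_ite, mul_one, mul_zero]
  exact_mod_cast hC4

lemma norm_circleSum_pow_four_le {r : ZMod p} (hp : p ≠ 2) (hr : r ≠ 0) {ξ : ZMod p × ZMod p}
    (hξ : ξ ≠ 0) : #(circle p 1) * ‖circleSum r ξ‖ ^ 4 ≤ 3 * (p : ℝ) ^ 2 * #(circle p r) ^ 2 := by
  calc (#(circle p 1) : ℝ) * ‖circleSum r ξ‖ ^ 4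
      = ∑ g ∈ circle p 1, ‖circleSum r (rot g ξ)‖ ^ 4 := by
        rw [sum_congr rfl fun g hg => by rw [circleSum_rot hg], sum_const, nsmul_eq_mul]
    _ = ∑ η ∈ (circle p 1).image fun g => rot g ξ, ‖circleSum r η‖ ^ 4 :=
        (sum_image (f := fun η => ‖circleSum r η‖ ^ 4) (rot_injective hp hξ)).symm
    _ ≤ ∑ η, ‖circleSum r η‖ ^ 4 :=
        sum_le_sum_of_subset_of_nonneg (subset_univ _) fun _ _ _ => by positivity
    _ ≤ (p : ℝ) ^ 2 * (3 * #(circle p r) ^ 2 : ℕ) := by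
        rw [sum_norm_circleSum_pow_four]
        gcongr
        exact circle_energy_le hp hr
    _ = 3 * (p : ℝ) ^ 2 * #(circle p r) ^ 2 := by
        push_cast
        ring

lemma neg_card_div_four_le_re_circleSum {r : ZMod p} (hp : 10000 ≤ p) (hr : r ≠ 0)
    (ξ : ZMod p × ZMod p) : -(#(circle p r) / 4 : ℝ) ≤ (circleSum r ξ).re := by
  by_cases hξ : ξ = 0
  · simp only [hξ, circleSum, planeChar, Prod.fst_zero, Prod.snd_zero, zero_mul, add_zero,
      AddChar.map_zero_eq_one, sum_const, nsmul_eq_mul, mul_one, Complex.natCast_re]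
    linarith [(Nat.cast_nonneg #(circle p r) : (0 : ℝ) ≤ _)]
  have h4 := norm_circleSum_pow_four_le (by omega) hr hξ
  have hu : (p : ℝ) ≤ #(circle p 1) + 2 := mod_cast le_card_unit_circle (by omega)
  have hle : (#(circle p 1) : ℝ) ≤ #(circle p r) := mod_cast card_unit_circle_le (by omega) hr
  have hpR : (10000 : ℝ) ≤ p := mod_cast hp
  set d : ℝ := (#(circle p r) : ℝ)
  set m : ℝ := (#(circle p 1) : ℝ)
  have hm : (p : ℝ) / 2 ≤ m := by linarith
  have hm0 : 0 < m := by linarith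
  have hkey : 3 * (p : ℝ) ^ 2 ≤ m * d ^ 2 / 256 := by
    have h1 : (p : ℝ) / 2 * (p / 2) ^ 2 ≤ m * d ^ 2 := by
      gcongr
      linarith
    nlinarith [sq_nonneg (p : ℝ)]
  have hnorm : ‖circleSum r ξ‖ ≤ d / 4 := by
    refine (pow_le_pow_iff_left₀ (norm_nonneg _) (by positivity) four_ne_zero).1 ?_
    refine le_of_mul_le_mul_left (h4.trans ?_) hm0
    calc 3 * (p : ℝ) ^ 2 * d ^ 2 ≤ m * d ^ 2 / 256 * d ^ 2 := by gcongr
      _ = m * (d / 4) ^ 4 := by ring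
  linarith [neg_le_of_abs_le ((Complex.abs_re_le_norm (circleSum r ξ)).trans hnorm)]

/-- The power spectrum of `f` determines its autocorrelations. -/
lemma sum_normSq_mul_planeChar (f : ZMod p × ZMod p → ℝ) (u : ZMod p × ZMod p) :
    ∑ ξ, ((‖∑ x, f x * planeChar ξ x‖ ^ 2 : ℝ) : ℂ) * planeChar ξ u =
      (p : ℂ) ^ 2 * ∑ x, (f x : ℂ) * f (x + u) := by
  have hpt (ξ : ZMod p × ZMod p) :
      ((‖∑ x, f x * planeChar ξ x‖ ^ 2 : ℝ) : ℂ) * planeChar ξ u =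
        ∑ x, ∑ y, (f x : ℂ) * f y * planeChar ξ (x + u - y) := by
    rw [Complex.ofReal_pow, ← Complex.mul_conj', map_sum, sum_mul_sum, sum_mul]
    refine sum_congr rfl fun x _ => ?_
    rw [sum_mul]
    refine sum_congr rfl fun y _ => ?_
    rw [map_mul, Complex.conj_ofReal, sub_eq_add_neg, planeChar_add, planeChar_add, planeChar_neg]
    ring
  simp only [hpt]
  rw [sum_comm, mul_sum]
  refine sum_congr rfl fun x _ => ?_
  rw [sum_comm]
  simp only [← mul_sum, sum_planeChar, sub_eq_zero, mul_ite, mul_zero, sum_ite_eq, mem_univ,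
    if_true]
  ring

/-- Sign patterns cannot be strongly anticorrelated along dilates of a circle. -/
lemma neg_le_sum_circle_correlation {r c : ZMod p} (hp : 10000 ≤ p) (hr : r ≠ 0)
    (f : ZMod p × ZMod p → ℝ) (hf : ∀ x, f x * f x = 1) :
    -(#(circle p r) / 4 * (p : ℝ) ^ 2) ≤ ∑ v ∈ circle p r, ∑ x, f x * f (x + c • v) := by
  have hp0 : (0 : ℝ) < p := by
    have : 0 < p := by omega
    exact_mod_cast this
  have hcard : ∑ x : ZMod p × ZMod p, (1 : ℝ) = (p : ℝ) ^ 2 := by simp [ZMod.card, sq]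
  have hpars : ∑ ξ, ‖∑ x, f x * planeChar ξ x‖ ^ 2 = (p : ℝ) ^ 2 * (p : ℝ) ^ 2 := by
    have h := sum_normSq_mul_planeChar f 0
    simp only [planeChar, Prod.fst_zero, Prod.snd_zero, mul_zero, add_zero,
      AddChar.map_zero_eq_one, mul_one] at h
    have h' : ∑ ξ, ‖∑ x, f x * planeChar ξ x‖ ^ 2 = (p : ℝ) ^ 2 * ∑ x, f x * f x := by
      exact_mod_cast h
    rw [h', ← hcard]
    simp only [hf]
  have hcorr : ∑ ξ, ‖∑ x, f x * planeChar ξ x‖ ^ 2 * (circleSum r (c • ξ)).re =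
      (p : ℝ) ^ 2 * ∑ v ∈ circle p r, ∑ x, f x * f (x + c • v) := by
    have h : ∑ ξ, ((‖∑ x, f x * planeChar ξ x‖ ^ 2 : ℝ) : ℂ) * circleSum r (c • ξ) =
        (((p : ℝ) ^ 2 * ∑ v ∈ circle p r, ∑ x, f x * f (x + c • v) : ℝ) : ℂ) := by
      simp only [circleSum, mul_sum, ← planeChar_smul]
      rw [sum_comm]
      simp only [sum_normSq_mul_planeChar, ← mul_sum]
      push_cast
      rfl
    have h' := congrArg Complex.re h
    rw [Complex.ofReal_re, Complex.re_sum] at h'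
    simpa only [Complex.re_ofReal_mul] using h'
  refine le_of_mul_le_mul_left (a := (p : ℝ) ^ 2) ?_ (by positivity)
  calc (p : ℝ) ^ 2 * -(#(circle p r) / 4 * (p : ℝ) ^ 2)
      = ∑ ξ, ‖∑ x, f x * planeChar ξ x‖ ^ 2 * -(#(circle p r) / 4 : ℝ) := by
        rw [← sum_mul, hpars]
        ring
    _ ≤ ∑ ξ, ‖∑ x, f x * planeChar ξ x‖ ^ 2 * (circleSum r (c • ξ)).re := by
        gcongr with ξ
        exact neg_card_div_four_le_re_circleSum hp hr _
    _ = _ := hcorr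

lemma exists_monochromatic_dilate {r c : ZMod p} (hp : 10000 ≤ p) (hr : r ≠ 0)
    (χ : ZMod p × ZMod p → Fin 2) :
    ∃ v ∈ circle p r, ∃ x, χ (x + v) = χ x ∧ χ (x + v + c • v) = χ x := by
  by_contra! hno
  set f : ZMod p × ZMod p → ℝ := fun x => if χ x = 0 then 1 else -1 with hfdef
  have hf (x) : f x * f x = 1 := by
    simp only [hfdef]
    split_ifs <;> norm_num
  have h₁ := neg_le_sum_circle_correlation (c := 1) hp hr f hf
  have h₂ := neg_le_sum_circle_correlation (c := c) hp hr f hf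
  have h₃ := neg_le_sum_circle_correlation (c := 1 + c) hp hr f hf
  have hshift (v : ZMod p × ZMod p) :
      ∑ x, f x * f (x + c • v) = ∑ x, f (x + v) * f (x + v + c • v) :=
    (Equiv.sum_comp (Equiv.addRight v) fun x => f x * f (x + c • v)).symm
  have hterm : ∀ v ∈ circle p r, ∀ x,
      f x * f (x + v) + f (x + v) * f (x + v + c • v) + f x * f (x + v + c • v) = -1 := by
    intro v hv x
    have hx := hno v hv x
    simp only [hfdef]
    generalize χ x = i at *
    generalize χ (x + v) = j at *
    generalize χ (x + v + c • v) = k at *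
    fin_cases i <;> fin_cases j <;> fin_cases k <;> simp_all
  have htotal : ∑ v ∈ circle p r, ∑ x, f x * f (x + (1 : ZMod p) • v) +
      ∑ v ∈ circle p r, ∑ x, f x * f (x + c • v) +
      ∑ v ∈ circle p r, ∑ x, f x * f (x + (1 + c) • v) = -(#(circle p r) * (p : ℝ) ^ 2) := by
    simp only [hshift, one_smul, add_smul, ← add_assoc, ← sum_add_distrib]
    rw [sum_congr rfl fun v hv => sum_congr rfl fun x _ => hterm v hv x]
    simp [ZMod.card, sq]
  have hpos : 0 < #(circle p r) * (p : ℝ) ^ 2 := by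
    have h₁ := le_card_unit_circle (p := p) (by omega)
    have h₂ := card_unit_circle_le (p := p) (by omega) hr
    have h₃ : 0 < #(circle p r) * p ^ 2 := Nat.mul_pos (by omega) (by positivity)
    exact_mod_cast h₃
  linarith

end CircleSums


/-- Shkredov: for sufficiently large primes `p`, any 2-colouring of `𝔽_p × 𝔽_p`
and any `a, b ≠ 0` with `a/b` a quadratic residue admit a monochromatic collinear
triple `x, y, z` with `‖y - x‖ = a` and `‖z - y‖ = b`, where
`‖v‖ = v₁² + v₂²`. -/
theorem monochromatic_collinear_triple :
    ∃ p₀ : ℕ, ∀ p : ℕ, p.Prime → p₀ ≤ p →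
      ∀ χ : ZMod p × ZMod p → Fin 2, ∀ a b : ZMod p, a ≠ 0 → b ≠ 0 →
        (∃ t : ZMod p, t ≠ 0 ∧ a = t ^ 2 * b) →
        ∃ x y z : ZMod p × ZMod p,
          x ≠ y ∧ y ≠ z ∧ x ≠ z ∧
          (∃ c : ZMod p, z - y = c • (y - x)) ∧
          (y - x).1 ^ 2 + (y - x).2 ^ 2 = a ∧
          (z - y).1 ^ 2 + (z - y).2 ^ 2 = b ∧
          χ y = χ x ∧ χ z = χ x := by
  refine ⟨10000, fun p hprime hp χ a b ha hb ⟨t, ht, hab⟩ => ?_⟩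
  have : Fact p.Prime := ⟨hprime⟩
  have h2 : (2 : ZMod p) ≠ 0 :=
    Ring.two_ne_zero (by rw [ZMod.ringChar_zmod_n]; omega)
  obtain ⟨c, hc, hc1, hcb⟩ : ∃ c : ZMod p, c ≠ 0 ∧ 1 + c ≠ 0 ∧ c ^ 2 * a = b := by
    by_cases h : t = -1
    · exact ⟨1, one_ne_zero, by rwa [one_add_one_eq_two], by simp [hab, h]⟩
    · refine ⟨t⁻¹, inv_ne_zero ht, fun h0 => h ?_, by rw [hab]; field_simp⟩
      rw [← inv_inv t, eq_neg_of_add_eq_zero_right h0, inv_neg, inv_one]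
  obtain ⟨v, hv, x, hxy, hxz⟩ := exists_monochromatic_dilate (c := c) hp ha χ
  rw [mem_circle] at hv
  have hv0 : v ≠ 0 := by
    rintro rfl
    exact ha (by simp [← hv])
  refine ⟨x, x + v, x + v + c • v, by simpa using hv0, by simpa [hc] using hv0, ?_,
    ⟨c, by simp⟩, by simpa using hv, ?_, hxy, hxz⟩
  · have : (1 + c) • v ≠ 0 := smul_ne_zero hc1 hv0
    rw [add_smul, one_smul] at this
    rwa [add_assoc, ne_eq, left_eq_add]
  · simp only [add_sub_cancel_left, Prod.smul_fst, Prod.smul_snd, smul_eq_mul]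
    linear_combination c ^ 2 * hv + hcb
end

section
/- There exists an absolute constant C > 0 such that for every prime p and every 2-colouring of 𝔽_p × 𝔽_p, the number of pairs (x, y) ∈ (𝔽_p × 𝔽_p)² such that the three points x, x + y, x + y⊥ all receive the same colour is at least p⁴/4 − C·p^{7/2}. -/
/-- Summing `f u * f v` along an injective reparametrization `(u, v)` of `V × V` gives a square,
hence a nonnegative number. -/
theorem sum_mul_comp_nonneg_of_injective {V : Type*} [Fintype V] (f : V → ℝ)
    (e : V × V → V × V) (he : Function.Injective e) :
    0 ≤ ∑ xy : V × V, f (e xy).1 * f (e xy).2 := by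
  have hb : Function.Bijective e := Finite.injective_iff_bijective.mp he
  rw [hb.sum_comp (fun uv : V × V => f uv.1 * f uv.2), Fintype.sum_prod_type,
    ← Finset.sum_mul_sum]
  exact mul_self_nonneg _

/-- The indicator that three elements of `Fin 2` agree, in terms of signs. -/
theorem ite_eq_and_eq_sign_identity (a b c : Fin 2) :
    (if b = a ∧ c = a then (1 : ℝ) else 0) =
      (1 + (-1) ^ (a : ℕ) * (-1) ^ (b : ℕ) + (-1) ^ (a : ℕ) * (-1) ^ (c : ℕ)
        + (-1) ^ (b : ℕ) * (-1) ^ (c : ℕ)) / 4 := by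
  fin_cases a <;> fin_cases b <;> fin_cases c <;> norm_num

/-- For an odd prime, at least a quarter of the isosceles right triangles are monochromatic. -/
theorem pow_four_div_four_le_card_monochromatic {p : ℕ} [Fact p.Prime] (hp : p ≠ 2)
    (χ : ZMod p × ZMod p → Fin 2) :
    (p : ℝ) ^ 4 / 4 ≤
      ((Finset.univ.filter
        (fun xy : (ZMod p × ZMod p) × (ZMod p × ZMod p) =>
          χ (xy.1 + xy.2) = χ xy.1 ∧
          χ (xy.1 + (-xy.2.2, xy.2.1)) = χ xy.1)).card : ℝ) := by
  have two_ne : (2 : ZMod p) ≠ 0 := by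
    exact_mod_cast ZMod.prime_ne_zero p 2 hp
  let f : ZMod p × ZMod p → ℝ := fun x => (-1) ^ (χ x : ℕ)
  have h₁ := sum_mul_comp_nonneg_of_injective f (fun xy => (xy.1, xy.1 + xy.2)) (by
    rintro ⟨x, y⟩ ⟨x', y'⟩ h
    simp only [Prod.mk.injEq] at h
    obtain ⟨rfl, h⟩ := h
    rw [add_left_cancel h])
  have h₂ := sum_mul_comp_nonneg_of_injective f
    (fun xy => (xy.1, xy.1 + (-xy.2.2, xy.2.1))) (by
    rintro ⟨x, y⟩ ⟨x', y'⟩ h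
    simp only [Prod.mk.injEq] at h
    obtain ⟨rfl, h⟩ := h
    have h := add_left_cancel h
    simp only [Prod.mk.injEq, neg_inj] at h
    rw [Prod.ext h.2 h.1])
  have h₃ := sum_mul_comp_nonneg_of_injective f
    (fun xy => (xy.1 + xy.2, xy.1 + (-xy.2.2, xy.2.1))) (by
    rintro ⟨⟨x₁, x₂⟩, ⟨y₁, y₂⟩⟩ ⟨⟨x₁', x₂'⟩, ⟨y₁', y₂'⟩⟩ h
    simp only [Prod.mk.injEq, Prod.mk_add_mk] at h
    obtain ⟨⟨ha, hb⟩, hc, hd⟩ := h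
    have hy₁ : y₁ = y₁' := mul_left_cancel₀ two_ne (by linear_combination ha - hb - hc + hd)
    have hy₂ : y₂ = y₂' := mul_left_cancel₀ two_ne (by linear_combination ha + hb - hc - hd)
    subst hy₁ hy₂
    rw [add_right_cancel ha, add_right_cancel hb])
  rw [← Finset.sum_boole]
  simp only [ite_eq_and_eq_sign_identity]
  rw [← Finset.sum_div, Finset.sum_add_distrib, Finset.sum_add_distrib, Finset.sum_add_distrib]
  have hcard : ∑ _xy : (ZMod p × ZMod p) × (ZMod p × ZMod p), (1 : ℝ) = (p : ℝ) ^ 4 := by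
    simp [ZMod.card]
    ring
  rw [hcard]
  simp only [f] at h₁ h₂ h₃
  linarith

/-- For any prime `p` and any 2-colouring of `𝔽_p × 𝔽_p`, the number of pairs
`(x, y)` such that `x, x + y, x + y⊥` (with `y⊥ = (-y₂, y₁)`) are monochromatic
is at least `p⁴/4 - C·p^(7/2)` for an absolute constant `C > 0`. -/
theorem monochromatic_isosceles_right_triangles_count :
    ∃ C : ℝ, 0 < C ∧ ∀ p : ℕ, ∀ _ : Fact p.Prime,
      ∀ χ : ZMod p × ZMod p → Fin 2,
        (p : ℝ) ^ 4 / 4 - C * (p : ℝ) ^ ((7 : ℝ) / 2) ≤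
          ((Finset.univ.filter
            (fun xy : (ZMod p × ZMod p) × (ZMod p × ZMod p) =>
              χ (xy.1 + xy.2) = χ xy.1 ∧
              χ (xy.1 + (-xy.2.2, xy.2.1)) = χ xy.1)).card : ℝ) := by
  refine ⟨1, one_pos, fun p _ χ => ?_⟩
  by_cases hp : p = 2
  · subst hp
    refine le_trans ?_ (Nat.cast_nonneg _)
    have h : (2 : ℝ) ^ (3 : ℝ) ≤ (2 : ℝ) ^ ((7 : ℝ) / 2) :=
      Real.rpow_le_rpow_of_exponent_le (by norm_num) (by norm_num)
    norm_num at h ⊢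
    linarith
  · have h : (0 : ℝ) ≤ (p : ℝ) ^ ((7 : ℝ) / 2) := by positivity
    linarith [pow_four_div_four_le_card_monochromatic hp χ]
end
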